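/- arXiv:2108.11132 — 2 statements merged into one kernel-verified Lean document; each statement's English description precedes it below -/
import Mathlib

section
/- Let P ⊂ ℝ^d be a lattice polytope, c ∈ ℚ^d, and ρ = den(c). Then for every positive integer t with t ≡ k (mod ρ), #(t(c+P) ∩ ℤ^d) = #((kc + tP) ∩ ℤ^d). Consequently, the k-th constituent of the Ehrhart quasi-polynomial L_{c+P} with respect to the period ρ equals the polynomial given by the translated lattice point enumerator L_{(P,kc)}. -/
open Pointwise MeasureTheory
open scoped RealInnerProductSpace

noncomputable section

/-- Cast an integer vector to a real vector. -/
def castVec {d : ℕ} (x : Fin d → ℤ) : Fin d → ℝ := fun i => (x i : ℝ)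

/-- Cast a rational vector to a real vector. -/
def ratVec {d : ℕ} (c : Fin d → ℚ) : Fin d → ℝ := fun i => (c i : ℝ)

/-- `den(c)`: the lcm of the denominators of the coordinates of a rational vector. -/
def denv {d : ℕ} (c : Fin d → ℚ) : ℕ := Finset.univ.lcm fun i => (c i).den

/-- The number of lattice points in a subset of `ℝ^d`. -/
def latCount {d : ℕ} (S : Set (Fin d → ℝ)) : ℕ := {x : Fin d → ℤ | castVec x ∈ S}.ncard

/-- A lattice polytope: the convex hull of a nonempty finite set of integer points. -/
def IsLatticePolytope {d : ℕ} (P : Set (Fin d → ℝ)) : Prop :=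
  ∃ V : Finset (Fin d → ℤ), V.Nonempty ∧ P = convexHull ℝ (castVec '' (V : Set (Fin d → ℤ)))

/-- The zonotope spanned by a finite set of integer vectors. -/
def zonotopeF {d : ℕ} (U : Finset (Fin d → ℤ)) : Set (Fin d → ℝ) :=
  {x | ∃ lam : (Fin d → ℤ) → ℝ, (∀ u, lam u ∈ Set.Icc (0 : ℝ) 1) ∧
    x = ∑ u ∈ U, lam u • castVec u}

/-- The zonotope spanned by integer vectors `u 0, …, u (n-1)`. -/
def zonotopeZ {d n : ℕ} (u : Fin n → Fin d → ℤ) : Set (Fin d → ℝ) :=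
  {x | ∃ lam : Fin n → ℝ, (∀ i, lam i ∈ Set.Icc (0 : ℝ) 1) ∧ x = ∑ i, lam i • castVec (u i)}

/-- The zonotope spanned by real vectors `u 0, …, u (n-1)`. -/
def zonotopeR {d n : ℕ} (u : Fin n → Fin d → ℝ) : Set (Fin d → ℝ) :=
  {x | ∃ lam : Fin n → ℝ, (∀ i, lam i ∈ Set.Icc (0 : ℝ) 1) ∧ x = ∑ i, lam i • u i}

/-- A zonotope: a translate of the Minkowski sum of finitely many segments `[0, uᵢ]`. -/
def IsZonotope {d : ℕ} (P : Set (Fin d → ℝ)) : Prop :=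
  ∃ (n : ℕ) (u : Fin n → Fin d → ℝ) (v : Fin d → ℝ), P = v +ᵥ zonotopeR u

/-- A set is centrally symmetric if it is a translate of its negation. -/
def CentrallySymmetric {d : ℕ} (P : Set (Fin d → ℝ)) : Prop :=
  ∃ v : Fin d → ℝ, P = v +ᵥ (-P)

/-- `f` is a family of constituents of `L` with respect to the period `ρ`. -/
def IsConstituents (L : ℕ → ℚ) (ρ : ℕ) (f : ℕ → Polynomial ℚ) : Prop :=
  ∀ t : ℕ, 0 < t → L t = (f (t % ρ)).eval (t : ℚ)

/-- `ρ` is a period of the quasi-polynomial `L`. -/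
def IsPeriodOf (ρ : ℕ) (L : ℕ → ℚ) : Prop := 0 < ρ ∧ ∃ f, IsConstituents L ρ f

/-- `ρ₀` is the minimal period of the quasi-polynomial `L`. -/
def IsMinimalPeriodOf (ρ₀ : ℕ) (L : ℕ → ℚ) : Prop :=
  IsPeriodOf ρ₀ L ∧ ∀ ρ : ℕ, IsPeriodOf ρ L → ρ₀ ≤ ρ

/-- GCD-property with respect to the period `ρ`: constituents with equal
`gcd(ρ, ·)` coincide. -/
def GCDProperty (L : ℕ → ℚ) (ρ : ℕ) : Prop :=
  ∀ f : ℕ → Polynomial ℚ, IsConstituents L ρ f →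
    ∀ k ℓ : ℕ, Nat.gcd ρ k = Nat.gcd ρ ℓ → f (k % ρ) = f (ℓ % ρ)

/-- Symmetry with respect to the period `ρ`: `f_k = f_{ρ-k}` for `0 ≤ k ≤ ρ`. -/
def SymmetricQP (L : ℕ → ℚ) (ρ : ℕ) : Prop :=
  ∀ f : ℕ → Polynomial ℚ, IsConstituents L ρ f →
    ∀ k : ℕ, k ≤ ρ → f (k % ρ) = f ((ρ - k) % ρ)

/-- The Ehrhart counting function `t ↦ #(t(c + P) ∩ ℤ^d)` of the translate `c + P`. -/
def ehr {d : ℕ} (P : Set (Fin d → ℝ)) (c : Fin d → ℚ) : ℕ → ℚ :=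
  fun t => (latCount ((t : ℝ) • (ratVec c +ᵥ P)) : ℚ)

/-- The dimension of a polytope: the dimension of the direction of its affine hull. -/
def polyDim {d : ℕ} (P : Set (Fin d → ℝ)) : ℕ := Module.finrank ℝ (affineSpan ℝ P).direction

/-- `r` is the relative volume of `P` (of dimension `m`): with respect to any lattice
point `v₀` of `P` and any `ℤ`-basis `b` of the lattice `aff₀(P) ∩ ℤ^d`, `r` is the
Lebesgue measure of `P` in the coordinates determined by `v₀` and `b`. -/
def IsRelVolOf {d : ℕ} (P : Set (Fin d → ℝ)) (m : ℕ) (r : ℝ) : Prop :=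
  ∀ (v₀ : Fin d → ℤ) (b : Fin m → Fin d → ℤ),
    castVec v₀ ∈ P → LinearIndependent ℤ b →
    (∀ x : Fin d → ℤ,
      castVec x ∈ (affineSpan ℝ P).direction ↔ x ∈ Submodule.span ℤ (Set.range b)) →
    r = (volume {lam : Fin m → ℝ | castVec v₀ + ∑ i, lam i • castVec (b i) ∈ P}).toReal

/-- The (real casts of the) elements of `W` are linearly independent over `ℝ`. -/
def LinIndepF {d : ℕ} (W : Finset (Fin d → ℤ)) : Prop :=
  LinearIndependent ℝ fun w : ↥W => castVec w.1

/-- Almost locally constant: locally constant outside a discrete point set. -/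
def AlmostLocallyConstant (f : ℝ → ℝ) : Prop :=
  ∃ D : Set ℝ, DiscreteTopology D ∧ IsLocallyConstant fun x : ↥(Dᶜ) => f ↑x

/-- Almost constant: constant outside a discrete point set. -/
def AlmostConstant (f : ℝ → ℝ) : Prop :=
  ∃ D : Set ℝ, DiscreteTopology D ∧ ∃ r : ℝ, ∀ x ∉ D, f x = r

/-- The face of `P` in the outer normal direction `v`. -/
def normalFace {d : ℕ} (P : Set (EuclideanSpace ℝ (Fin d)))
    (v : EuclideanSpace ℝ (Fin d)) : Set (EuclideanSpace ℝ (Fin d)) :=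
  {x | x ∈ P ∧ ∀ y ∈ P, ⟪y, v⟫ ≤ ⟪x, v⟫}

/-- `F` is a facet of the `d`-polytope `P`: an exposed face of dimension `d - 1`. -/
def IsFacetOf {d : ℕ} (F P : Set (EuclideanSpace ℝ (Fin d))) : Prop :=
  (∃ v : EuclideanSpace ℝ (Fin d), v ≠ 0 ∧ F = normalFace P v) ∧
  Module.finrank ℝ (affineSpan ℝ F).direction = d - 1

/-- Lattice point counts are invariant under translation by integer vectors. -/
theorem latCount_castVec_vadd {d : ℕ} (w : Fin d → ℤ) (S : Set (Fin d → ℝ)) :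
    latCount (castVec w +ᵥ S) = latCount S := by
  unfold latCount
  have h : {x : Fin d → ℤ | castVec x ∈ castVec w +ᵥ S} =
      (fun x => w + x) '' {x : Fin d → ℤ | castVec x ∈ S} := by
    ext x
    have hx : -castVec w + castVec x = castVec (-w + x) := by
      ext i
      simp [castVec]
    simp [Set.mem_vadd_set_iff_neg_vadd_mem, hx]
  rw [h, Set.ncard_image_of_injective _ (add_right_injective w)]

theorem denv_pos {d : ℕ} (c : Fin d → ℚ) : 0 < denv c :=
  Nat.pos_of_ne_zero fun h => by
    obtain ⟨i, -, hi⟩ := Finset.lcm_eq_zero_iff.mp h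
    exact (c i).den_nz hi

/-- An integer multiple of `denv c` scales `c` to an integer vector. -/
theorem exists_castVec_eq_smul_ratVec {d : ℕ} (c : Fin d → ℚ) {n : ℤ} (hn : (denv c : ℤ) ∣ n) :
    ∃ w : Fin d → ℤ, castVec w = (n : ℝ) • ratVec c := by
  have h (i : Fin d) : ∃ z : ℤ, (z : ℝ) = (n : ℝ) * (c i : ℝ) := by
    have hi : ((c i).den : ℤ) ∣ n :=
      (Int.natCast_dvd_natCast.mpr (Finset.dvd_lcm (Finset.mem_univ i))).trans hn
    obtain ⟨m, rfl⟩ := hi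
    refine ⟨m * (c i).num, ?_⟩
    have hq : ((m * (c i).num : ℤ) : ℚ) = (((c i).den * m : ℤ) : ℚ) * c i := by
      push_cast
      rw [← Rat.den_mul_eq_num (c i)]
      ring
    exact_mod_cast congrArg (fun q : ℚ => (q : ℝ)) hq
  choose w hw using h
  exact ⟨w, funext fun i => by simpa [castVec, ratVec] using hw i⟩

/-- The lattice point count of `t(c + P)` depends on the translation only through the residue
of `t` modulo `denv c`. -/
theorem latCount_smul_vadd_eq_of_modEq {d : ℕ} (P : Set (Fin d → ℝ)) (c : Fin d → ℚ) {t k : ℕ}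
    (h : t ≡ k [MOD denv c]) :
    latCount ((t : ℝ) • (ratVec c +ᵥ P)) = latCount ((k • ratVec c) +ᵥ (t : ℝ) • P) := by
  obtain ⟨w, hw⟩ := exists_castVec_eq_smul_ratVec c (Nat.modEq_iff_dvd.mp h.symm)
  have hsum : (t : ℝ) • ratVec c = castVec w + k • ratVec c := by
    rw [hw, ← Nat.cast_smul_eq_nsmul ℝ, ← add_smul]
    simp
  have hset : (t : ℝ) • (ratVec c +ᵥ P) = castVec w +ᵥ ((k • ratVec c) +ᵥ (t : ℝ) • P) := by
    rw [vadd_vadd, ← hsum, ← Set.singleton_vadd, ← Set.singleton_vadd, vadd_eq_add, vadd_eq_add,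
      smul_add, Set.smul_set_singleton]
  rw [hset, latCount_castVec_vadd]

/-- For a lattice polytope `P`, `c ∈ ℚ^d`, `ρ = den(c)` and `t ≡ k (mod ρ)`,
`#(t(c+P) ∩ ℤ^d) = #((kc + tP) ∩ ℤ^d)`; consequently the `k`-th constituent of
`L_{c+P}` equals the polynomial given by the translated lattice point enumerator
`L_{(P,kc)}`. -/
theorem constituent_eq_translated_lattice_point_enumerator
    (d : ℕ) (P : Set (Fin d → ℝ)) (hP : IsLatticePolytope P)
    (c : Fin d → ℚ) (k : ℕ) :
    (∀ t : ℕ, 0 < t → t % denv c = k % denv c →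
      latCount ((t : ℝ) • (ratVec c +ᵥ P)) = latCount ((k • ratVec c) +ᵥ (t : ℝ) • P)) ∧
    (∀ f : ℕ → Polynomial ℚ, IsConstituents (ehr P c) (denv c) f →
      ∀ g : Polynomial ℚ,
        (∀ t : ℕ, 0 < t → (latCount ((k • ratVec c) +ᵥ (t : ℝ) • P) : ℚ) = g.eval (t : ℚ)) →
        f (k % denv c) = g) := by
  have hcount (t : ℕ) (ht : t % denv c = k % denv c) :=
    latCount_smul_vadd_eq_of_modEq P c (t := t) (k := k) ht
  refine ⟨fun t _ ht => hcount t ht, fun f hf g hg => ?_⟩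
  have hρ := denv_pos c
  let s : ℕ → ℕ := fun n => k + denv c * (n + 1)
  have hs : Function.Injective fun n => (s n : ℚ) := fun a b hab => by
    have hab' : s a = s b := Nat.cast_injective hab
    simpa [s, hρ.ne'] using hab'
  refine Polynomial.eq_of_infinite_eval_eq _ _ ((Set.infinite_range_of_injective hs).mono ?_)
  rintro _ ⟨n, rfl⟩
  have hpos : 0 < s n := by positivity
  have hmod : s n % denv c = k % denv c := Nat.add_mul_mod_self_left _ _ _
  change (f (k % denv c)).eval (s n : ℚ) = g.eval (s n : ℚ)
  rw [← hmod, ← hf _ hpos, ← hg _ hpos, ehr, hcount _ hmod]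
end
end

section
/- Let P ⊂ ℝ^d be a d-dimensional polytope. Then P is centrally symmetric if and only if for each facet F of P there exists a facet F^op of P parallel to F (lying on the opposite side, i.e., with outer normal vector opposite to that of F) such that vol_{d−1}(F) = vol_{d−1}(F^op), where vol_{d−1} denotes (d−1)-dimensional Euclidean volume. -/
open Pointwise MeasureTheory
open scoped RealInnerProductSpace

noncomputable section

section BrunnMinkowski

open scoped ENNReal

/-- One-dimensional Brunn–Minkowski inequality. -/
theorem volume_add_volume_le_of_add_mem {X Y Z : Set ℝ} (hX : MeasurableSet X)
    (hY : MeasurableSet Y) (hXn : X.Nonempty) (hYn : Y.Nonempty)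
    (h : ∀ x ∈ X, ∀ y ∈ Y, x + y ∈ Z) : volume X + volume Y ≤ volume Z := by
  have compact_case : ∀ K K' : Set ℝ, IsCompact K → IsCompact K' → K.Nonempty → K'.Nonempty →
      K ⊆ X → K' ⊆ Y → volume K + volume K' ≤ volume Z := by
    intro K K' hK hK' hKn hKn' hKX hKY
    set a := sSup K
    set b := sInf K'
    have ha : a ∈ K := hK.sSup_mem hKn
    have hb : b ∈ K' := hK'.sInf_mem hKn'
    have h1 : volume ((fun x => x + b) '' K) = volume K := by simp
    have h2 : volume ((fun y => a + y) '' K') = volume K' := by simp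
    have hd : AEDisjoint volume ((fun x => x + b) '' K) ((fun y => a + y) '' K') := by
      refine measure_mono_null (t := {a + b}) ?_ (by simp)
      rintro _ ⟨⟨x, hx, rfl⟩, ⟨y, hy, hxy⟩⟩
      have hxa : x ≤ a := le_csSup hK.bddAbove hx
      have hyb : b ≤ y := csInf_le hK'.bddBelow hy
      simp only [Set.mem_singleton_iff] at *
      linarith
    rw [← h1, ← h2, ← measure_union₀ _ hd]
    · refine measure_mono ?_
      rintro _ (⟨x, hx, rfl⟩ | ⟨y, hy, rfl⟩)
      · exact h _ (hKX hx) _ (hKY hb)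
      · exact h _ (hKX ha) _ (hKY hy)
    · exact (hK'.image (by fun_prop)).measurableSet.nullMeasurableSet
  obtain ⟨x₀, hx₀⟩ := hXn
  obtain ⟨y₀, hy₀⟩ := hYn
  rw [hX.measure_eq_iSup_isCompact, hY.measure_eq_iSup_isCompact]
  simp only [iSup_and']
  refine ENNReal.biSup_add_biSup_le' ⟨∅, by simp⟩ ⟨∅, by simp⟩ fun K hK K' hK' => ?_
  refine (add_le_add (measure_mono (Set.subset_insert x₀ K))
    (measure_mono (Set.subset_insert y₀ K'))).trans ?_
  exact compact_case _ _ (hK.2.insert _) (hK'.2.insert _) ⟨x₀, by simp⟩ ⟨y₀, by simp⟩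
    (Set.insert_subset hx₀ hK.1) (Set.insert_subset hy₀ hK'.1)

theorem volume_add_volume_le_of_half_add_mem {X Y Z : Set ℝ} (hX : MeasurableSet X)
    (hY : MeasurableSet Y) (hXn : X.Nonempty) (hYn : Y.Nonempty)
    (h : ∀ x ∈ X, ∀ y ∈ Y, (x + y) / 2 ∈ Z) : volume X + volume Y ≤ 2 * volume Z := by
  have := volume_add_volume_le_of_add_mem (Z := (2 : ℝ) • Z) hX hY hXn hYn fun x hx y hy =>
    ⟨(x + y) / 2, h x hx y hy, by simp; ring⟩
  rw [Measure.addHaar_smul] at this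
  simpa using this

/-- Normalised one-dimensional Prékopa–Leindler inequality. -/
theorem lintegral_add_lintegral_le_of_mul_le_sq {f g h : ℝ → ℝ} (hf : Measurable f)
    (hg : Measurable g) (hh : Measurable h) (hf0 : ∀ s, 0 ≤ f s) (hg0 : ∀ s, 0 ≤ g s)
    (hh0 : ∀ s, 0 ≤ h s) (hf1 : ∀ s, f s ≤ 1) (hg1 : ∀ s, g s ≤ 1)
    (hf2 : ∀ t < 1, ∃ s, t < f s) (hg2 : ∀ t < 1, ∃ s, t < g s)
    (H : ∀ s s', f s * g s' ≤ h ((s + s') / 2) ^ 2) :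
    (∫⁻ s, ENNReal.ofReal (f s)) + ∫⁻ s, ENNReal.ofReal (g s) ≤
      2 * ∫⁻ s, ENNReal.ofReal (h s) := by
  have anti : ∀ k : ℝ → ℝ, Measurable fun t : ℝ => volume {a : ℝ | t < k a} := fun k =>
    Antitone.measurable fun s t hst => measure_mono fun a (ha : t < k a) => lt_of_le_of_lt hst ha
  rw [lintegral_eq_lintegral_meas_lt _ (.of_forall hf0) hf.aemeasurable,
    lintegral_eq_lintegral_meas_lt _ (.of_forall hg0) hg.aemeasurable,
    lintegral_eq_lintegral_meas_lt _ (.of_forall hh0) hh.aemeasurable,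
    ← lintegral_add_left (anti f), ← lintegral_const_mul _ (anti h)]
  refine setLIntegral_mono ((anti h).const_mul _) fun t ht => ?_
  have ht : 0 < t := ht
  by_cases h1 : t < 1
  · refine volume_add_volume_le_of_half_add_mem (measurableSet_lt measurable_const hf)
      (measurableSet_lt measurable_const hg) (hf2 t h1) (hg2 t h1) fun x hx y hy => ?_
    have hx : t < f x := hx
    have hy : t < g y := hy
    refine lt_of_pow_lt_pow_left₀ 2 (hh0 _) (lt_of_lt_of_le ?_ (H x y))
    nlinarith
  · have e1 : {a | t < f a} = ∅ := by
      ext a; simpa using (hf1 a).trans (not_lt.1 h1)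
    have e2 : {a | t < g a} = ∅ := by
      ext a; simpa using (hg1 a).trans (not_lt.1 h1)
    simp [e1, e2]

/-- One-dimensional Prékopa–Leindler inequality for bounded functions. -/
theorem lintegral_mul_lintegral_le_sq {f g h : ℝ → ℝ} {M : ℝ} (hf : Measurable f)
    (hg : Measurable g) (hh : Measurable h) (hf0 : ∀ s, 0 ≤ f s) (hg0 : ∀ s, 0 ≤ g s)
    (hh0 : ∀ s, 0 ≤ h s) (hfM : ∀ s, f s ≤ M) (hgM : ∀ s, g s ≤ M)
    (H : ∀ s s', f s * g s' ≤ h ((s + s') / 2) ^ 2) :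
    (∫⁻ s, ENNReal.ofReal (f s)) * ∫⁻ s, ENNReal.ofReal (g s) ≤
      (∫⁻ s, ENNReal.ofReal (h s)) ^ 2 := by
  have hfb : BddAbove (Set.range f) := ⟨M, by rintro _ ⟨s, rfl⟩; exact hfM s⟩
  have hgb : BddAbove (Set.range g) := ⟨M, by rintro _ ⟨s, rfl⟩; exact hgM s⟩
  set a := ⨆ s, f s
  set b := ⨆ s, g s
  have hfa : ∀ s, f s ≤ a := le_ciSup hfb
  have hgb' : ∀ s, g s ≤ b := le_ciSup hgb
  rcases ((hf0 0).trans (hfa 0)).eq_or_lt with ha | ha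
  · simp [fun s => ENNReal.ofReal_of_nonpos ((hfa s).trans ha.symm.le)]
  rcases ((hg0 0).trans (hgb' 0)).eq_or_lt with hb | hb
  · simp [fun s => ENNReal.ofReal_of_nonpos ((hgb' s).trans hb.symm.le)]
  set c := √(a * b)
  have hc : 0 < c := Real.sqrt_pos.2 (mul_pos ha hb)
  have hcc : c ^ 2 = a * b := Real.sq_sqrt (mul_pos ha hb).le
  have key := lintegral_add_lintegral_le_of_mul_le_sq (f := fun s => f s / a)
    (g := fun s => g s / b) (h := fun s => h s / c) (hf.div_const _) (hg.div_const _)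
    (hh.div_const _) (fun s => div_nonneg (hf0 s) ha.le) (fun s => div_nonneg (hg0 s) hb.le)
    (fun s => div_nonneg (hh0 s) hc.le) (fun s => (div_le_one ha).2 (hfa s))
    (fun s => (div_le_one hb).2 (hgb' s))
    (fun t ht => by
      obtain ⟨s, hs⟩ := exists_lt_of_lt_ciSup (show t * a < ⨆ s, f s by
        change t * a < a; nlinarith)
      exact ⟨s, (lt_div_iff₀ ha).2 hs⟩)
    (fun t ht => by
      obtain ⟨s, hs⟩ := exists_lt_of_lt_ciSup (show t * b < ⨆ s, g s by
        change t * b < b; nlinarith)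
      exact ⟨s, (lt_div_iff₀ hb).2 hs⟩)
    (fun s s' => by
      rw [div_mul_div_comm, div_pow, hcc]
      exact div_le_div_of_nonneg_right (H s s') (mul_pos ha hb).le)
  have conv : ∀ (k : ℝ → ℝ) (c : ℝ), 0 < c → Measurable k →
      ∫⁻ s, ENNReal.ofReal (k s) = ENNReal.ofReal c * ∫⁻ s, ENNReal.ofReal (k s / c) := by
    intro k c hc hk
    rw [← lintegral_const_mul _ (by fun_prop)]
    refine lintegral_congr fun s => ?_
    rw [← ENNReal.ofReal_mul hc.le, mul_div_cancel₀ _ hc.ne']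
  rw [conv f a ha hf, conv g b hb hg, conv h c hc hh]
  generalize ∫⁻ s, ENNReal.ofReal (f s / a) = x at *
  generalize ∫⁻ s, ENNReal.ofReal (g s / b) = y at *
  generalize ∫⁻ s, ENNReal.ofReal (h s / c) = z at *
  have hxyz : x * y ≤ z ^ 2 := by
    by_cases hz : z = ∞
    · simp [hz]
    have hxy : x + y ≠ ∞ := ne_top_of_le_ne_top (by finiteness) key
    have hx : x ≠ ∞ := ne_top_of_le_ne_top hxy le_self_add
    have hy : y ≠ ∞ := ne_top_of_le_ne_top hxy le_add_self
    lift x to NNReal using hx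
    lift y to NNReal using hy
    lift z to NNReal using hz
    norm_cast at key ⊢
    rw [← NNReal.coe_le_coe] at key ⊢
    push_cast at key ⊢
    have hx := x.coe_nonneg
    have hy := y.coe_nonneg
    nlinarith [sq_nonneg ((x : ℝ) - y)]
  calc ENNReal.ofReal a * x * (ENNReal.ofReal b * y)
      = (ENNReal.ofReal a * ENNReal.ofReal b) * (x * y) := by ring
    _ = ENNReal.ofReal c ^ 2 * (x * y) := by
        rw [← ENNReal.ofReal_mul ha.le, ← hcc, ENNReal.ofReal_pow hc.le]
    _ ≤ ENNReal.ofReal c ^ 2 * z ^ 2 := by gcongr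
    _ = (ENNReal.ofReal c * z) ^ 2 := by ring

theorem piFinSuccAbove_zero_symm_apply {n : ℕ} (s : ℝ) (y : Fin n → ℝ) :
    (MeasurableEquiv.piFinSuccAbove (fun _ : Fin (n + 1) => ℝ) 0).symm (s, y) = Fin.cons s y :=
  Fin.insertNth_zero' s y

theorem volume_pi_succ_eq_lintegral {n : ℕ} {A : Set (Fin (n + 1) → ℝ)} (hA : MeasurableSet A) :
    volume A = ∫⁻ s : ℝ, volume {y : Fin n → ℝ | Fin.cons s y ∈ A} := by
  have mp := (volume_preserving_piFinSuccAbove (fun _ : Fin (n + 1) => ℝ) 0).symm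
  rw [← mp.measure_preimage_equiv, Measure.volume_eq_prod,
    Measure.prod_apply (mp.measurable hA)]
  simp only [Set.preimage, piFinSuccAbove_zero_symm_apply, Set.mem_ofPred_eq]

/-- Multiplicative Brunn–Minkowski inequality in a box. -/
theorem volume_mul_volume_le_sq_of_subset_Icc (n : ℕ) (R : ℝ) :
    ∀ A B C : Set (Fin n → ℝ), MeasurableSet A → MeasurableSet B → MeasurableSet C →
      A ⊆ Set.Icc (fun _ => -R) (fun _ => R) → B ⊆ Set.Icc (fun _ => -R) (fun _ => R) →
      C ⊆ Set.Icc (fun _ => -R) (fun _ => R) →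
      (∀ a ∈ A, ∀ b ∈ B, (1 / 2 : ℝ) • (a + b) ∈ C) → volume A * volume B ≤ volume C ^ 2 := by
  induction n with
  | zero =>
    intro A B C _ _ _ _ _ _ H
    rcases A.eq_empty_or_nonempty with rfl | ⟨a, ha⟩
    · simp
    rcases B.eq_empty_or_nonempty with rfl | ⟨b, hb⟩
    · simp
    have e : ∀ S : Set (Fin 0 → ℝ), S.Nonempty → S = Set.univ := fun S hS =>
      Subsingleton.eq_univ_of_nonempty hS
    rw [e A ⟨a, ha⟩, e B ⟨b, hb⟩, e C ⟨_, H a ha b hb⟩]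
    simp [volume_pi]
  | succ n ih =>
    intro A B C hA hB hC hAR hBR hCR H
    have hcons : ∀ s : ℝ, Measurable fun y : Fin n → ℝ => (Fin.cons s y : Fin (n + 1) → ℝ) :=
      fun s => by
        refine measurable_pi_iff.2 fun i => ?_
        refine Fin.cases ?_ (fun i => ?_) i
        · simp
        · simpa using measurable_pi_apply i
    have hmeas : ∀ S : Set (Fin (n + 1) → ℝ), MeasurableSet S →
        Measurable fun s : ℝ => volume {y : Fin n → ℝ | Fin.cons s y ∈ S} := by
      intro S hS
      have mp := (volume_preserving_piFinSuccAbove (fun _ : Fin (n + 1) => ℝ) 0).symm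
      have := measurable_measure_prodMk_left (ν := (volume : Measure (Fin n → ℝ)))
        (mp.measurable hS)
      simpa only [Set.preimage, piFinSuccAbove_zero_symm_apply, Set.mem_ofPred_eq] using this
    have hsub : ∀ S : Set (Fin (n + 1) → ℝ), S ⊆ Set.Icc (fun _ => -R) (fun _ => R) → ∀ s : ℝ,
        {y : Fin n → ℝ | Fin.cons s y ∈ S} ⊆ Set.Icc (fun _ => -R) (fun _ => R) := by
      intro S hS s y hy
      have := hS hy
      exact ⟨fun i => by simpa using this.1 i.succ, fun i => by simpa using this.2 i.succ⟩
    have hfin : volume (Set.Icc (fun _ : Fin n => -R) (fun _ => R)) ≠ ∞ :=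
      isCompact_Icc.measure_ne_top
    have hne : ∀ S : Set (Fin (n + 1) → ℝ), S ⊆ Set.Icc (fun _ => -R) (fun _ => R) → ∀ s : ℝ,
        volume {y : Fin n → ℝ | Fin.cons s y ∈ S} ≠ ∞ := fun S hS s =>
      ne_top_of_le_ne_top hfin (measure_mono (hsub S hS s))
    have hofReal : ∀ S : Set (Fin (n + 1) → ℝ), MeasurableSet S →
        S ⊆ Set.Icc (fun _ => -R) (fun _ => R) →
        volume S = ∫⁻ s : ℝ, ENNReal.ofReal (volume {y : Fin n → ℝ | Fin.cons s y ∈ S}).toReal := by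
      intro S hS hSR
      rw [volume_pi_succ_eq_lintegral hS]
      exact lintegral_congr fun s => (ENNReal.ofReal_toReal (hne S hSR s)).symm
    rw [hofReal A hA hAR, hofReal B hB hBR, hofReal C hC hCR]
    refine lintegral_mul_lintegral_le_sq
      (M := (volume (Set.Icc (fun _ : Fin n => -R) (fun _ => R))).toReal)
      (hmeas A hA).ennreal_toReal (hmeas B hB).ennreal_toReal (hmeas C hC).ennreal_toReal
      (fun _ => ENNReal.toReal_nonneg) (fun _ => ENNReal.toReal_nonneg)
      (fun _ => ENNReal.toReal_nonneg)
      (fun s => ENNReal.toReal_mono hfin (measure_mono (hsub A hAR s)))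
      (fun s => ENNReal.toReal_mono hfin (measure_mono (hsub B hBR s))) fun s s' => ?_
    rw [← ENNReal.toReal_mul, ← ENNReal.toReal_pow]
    refine ENNReal.toReal_mono (ENNReal.pow_ne_top (hne C hCR _)) ?_
    refine ih _ _ _ (hcons s hA) (hcons s' hB) (hcons _ hC) (hsub A hAR s) (hsub B hBR s')
      (hsub C hCR _) fun a ha b hb => ?_
    have := H _ ha _ hb
    simp only [Set.mem_ofPred_eq]
    convert this using 1
    ext i
    refine Fin.cases ?_ (fun i => ?_) i
    · simp; ring
    · simp; ring

/-- Multiplicative Brunn–Minkowski inequality for bounded measurable sets. -/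
theorem volume_mul_volume_le_sq {d : ℕ} {A B C : Set (EuclideanSpace ℝ (Fin d))}
    (hA : MeasurableSet A) (hB : MeasurableSet B) (hC : MeasurableSet C)
    (hAb : Bornology.IsBounded A) (hBb : Bornology.IsBounded B)
    (H : ∀ a ∈ A, ∀ b ∈ B, (1 / 2 : ℝ) • (a + b) ∈ C) :
    volume A * volume B ≤ volume C ^ 2 := by
  obtain ⟨R, hR⟩ := (hAb.union hBb).exists_norm_le
  have mp := PiLp.volume_preserving_toLp (Fin d)
  set Q : Set (Fin d → ℝ) := Set.Icc (fun _ => -R) (fun _ => R)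
  have hbox : ∀ S : Set (EuclideanSpace ℝ (Fin d)), S ⊆ A ∪ B →
      WithLp.toLp 2 ⁻¹' S ⊆ Q := by
    intro S hS y hy
    have h1 := hR _ (hS hy)
    have h2 : ∀ i, |y i| ≤ R := fun i => by
      simpa using (PiLp.norm_apply_le (WithLp.toLp 2 y) i).trans h1
    exact ⟨fun i => (abs_le.1 (h2 i)).1, fun i => (abs_le.1 (h2 i)).2⟩
  rw [← mp.measure_preimage hA.nullMeasurableSet, ← mp.measure_preimage hB.nullMeasurableSet,
    ← mp.measure_preimage hC.nullMeasurableSet]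
  refine (volume_mul_volume_le_sq_of_subset_Icc d R _ _ (WithLp.toLp 2 ⁻¹' C ∩ Q)
    (mp.measurable hA) (mp.measurable hB) ((mp.measurable hC).inter measurableSet_Icc)
    (hbox A Set.subset_union_left) (hbox B Set.subset_union_right) Set.inter_subset_right
    fun a ha b hb => ⟨?_, ?_⟩).trans (by gcongr; exact Set.inter_subset_left)
  · simpa using H _ ha _ hb
  · have h1 := hbox A Set.subset_union_left ha
    have h2 := hbox B Set.subset_union_right hb
    constructor <;> intro i
    · have := h1.1 i; have := h2.1 i; simp at *; linarith
    · have := h1.2 i; have := h2.2 i; simp at *; linarith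

end BrunnMinkowski

/-- `φ` is the quantile function of `F` (of total mass `V`) on a logarithmic scale. -/
def IsLogQuantile (F : ℝ → ℝ) (V : ℝ) (φ : ℝ → ℝ) : Prop :=
  ∀ x ≤ 0, F (φ x) = V * Real.exp x ∧ ∀ s, V * Real.exp x ≤ F s ↔ φ x ≤ s

theorem exists_isLogQuantile {F : ℝ → ℝ} {V a b : ℝ} (hV : 0 < V) (hm : Monotone F)
    (hc : Continuous F) (ha : F a = 0) (hb : F b = V) : ∃ φ, IsLogQuantile F V φ := by
  have key : ∀ x : ℝ, ∃ z, x ≤ 0 → F z = V * Real.exp x ∧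
      ∀ s, V * Real.exp x ≤ F s ↔ z ≤ s := by
    intro x
    by_cases hx : x ≤ 0
    swap
    · exact ⟨0, fun h => absurd h hx⟩
    set τ := V * Real.exp x with hτ
    have hτ0 : 0 < τ := by positivity
    have hτV : τ ≤ V := by
      have : Real.exp x ≤ 1 := Real.exp_le_one_iff.2 hx
      nlinarith
    have hne : {s | τ ≤ F s}.Nonempty := ⟨b, by simpa [hb] using hτV⟩
    have hbd : BddBelow {s | τ ≤ F s} := by
      refine ⟨a, fun s hs => ?_⟩
      by_contra! h
      have h1 : τ ≤ F s := hs
      have := hm h.le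
      linarith
    have hcl : IsClosed {s | τ ≤ F s} := isClosed_le continuous_const hc
    have hmem : τ ≤ F (sInf {s | τ ≤ F s}) := hcl.csInf_mem hne hbd
    refine ⟨sInf {s | τ ≤ F s}, fun _ => ⟨le_antisymm ?_ hmem, fun s =>
      ⟨fun h => csInf_le hbd h, fun h => hmem.trans (hm h)⟩⟩⟩
    have ht : Filter.Tendsto F (nhdsWithin (sInf {s | τ ≤ F s}) (Set.Iio (sInf {s | τ ≤ F s})))
        (nhds (F (sInf {s | τ ≤ F s}))) := hc.continuousAt.tendsto.mono_left nhdsWithin_le_nhds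
    refine le_of_tendsto ht ?_
    filter_upwards [self_mem_nhdsWithin] with s hs
    by_contra! h
    exact absurd (csInf_le hbd (show s ∈ {s | τ ≤ F s} from h.le)) (not_le.2 hs)
  choose φ hφ using key
  exact ⟨φ, hφ⟩

theorem logQuantile_midpoint_le {F G H : ℝ → ℝ} {V : ℝ} (hV : 0 < V) {φ ψ : ℝ → ℝ}
    (hφ : IsLogQuantile F V φ) (hψ : IsLogQuantile G V ψ) (hH0 : ∀ s, 0 ≤ H s)
    (hHV : ∀ s, H s ≤ V)
    (h1 : ∀ s t, F s * G t ≤ H ((s + t) / 2) ^ 2)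
    (h2 : ∀ s t, (V - F s) * (V - G t) ≤ (V - H ((s + t) / 2)) ^ 2)
    {x y : ℝ} (hx : x ≤ 0) (hy : y ≤ 0) :
    φ ((x + y) / 2) + ψ ((x + y) / 2) ≤ φ x + ψ y := by
  by_contra! hlt
  set m := (x + y) / 2 with hm
  have hm0 : m ≤ 0 := by linarith
  set e := (φ m + ψ m - φ x - ψ y) / 2 with he
  have he0 : 0 < e := by linarith
  have hF : F (φ m - e) < V * Real.exp m := by
    rw [← not_le, (hφ m hm0).2]; linarith
  have hG : G (ψ m - e) < V * Real.exp m := by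
    rw [← not_le, (hψ m hm0).2]; linarith
  have hmV : V * Real.exp m ≤ V := by
    have : Real.exp m ≤ 1 := Real.exp_le_one_iff.2 hm0
    nlinarith
  have a1 := h1 (φ x) (ψ y)
  have a2 := h2 (φ m - e) (ψ m - e)
  have hs : (φ m - e + (ψ m - e)) / 2 = (φ x + ψ y) / 2 := by rw [he]; ring
  rw [hs] at a2
  set K := H ((φ x + ψ y) / 2)
  rw [(hφ x hx).1, (hψ y hy).1] at a1
  have hexp : V * Real.exp x * (V * Real.exp y) = (V * Real.exp m) ^ 2 := by
    have : Real.exp x * Real.exp y = Real.exp m ^ 2 := by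
      rw [← Real.exp_add, ← Real.exp_nat_mul, hm]; congr 1; push_cast; ring
    linear_combination V ^ 2 * this
  rw [hexp] at a1
  have hK : V * Real.exp m ≤ K := by
    have := sq_le_sq.1 a1
    rwa [abs_of_nonneg (by positivity), abs_of_nonneg (hH0 _)] at this
  have hKV : K ≤ V := hHV _
  have : (V - K) ^ 2 < (V - F (φ m - e)) * (V - G (ψ m - e)) := by
    have b1 : V - V * Real.exp m < V - F (φ m - e) := by linarith
    have b2 : V - V * Real.exp m < V - G (ψ m - e) := by linarith
    have b3 : V - K ≤ V - V * Real.exp m := by linarith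
    nlinarith
  linarith

theorem logQuantile_sub_le {F G H : ℝ → ℝ} {V : ℝ} (hV : 0 < V) {φ ψ : ℝ → ℝ}
    (hφ : IsLogQuantile F V φ) (hψ : IsLogQuantile G V ψ)
    (hH0 : ∀ s, 0 ≤ H s) (hHV : ∀ s, H s ≤ V)
    (h1 : ∀ s t, F s * G t ≤ H ((s + t) / 2) ^ 2)
    (h2 : ∀ s t, (V - F s) * (V - G t) ≤ (V - H ((s + t) / 2)) ^ 2)
    {p r : ℝ} (hpr : p < r) (hr : r ≤ 0) : ψ r - ψ p ≤ φ r - φ p := by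
  have hmono : ∀ {x y : ℝ}, x ≤ y → y ≤ 0 → ψ x ≤ ψ y := by
    intro x y hxy hy
    rw [← (hψ x (hxy.trans hy)).2, (hψ y hy).1]
    gcongr
  have tele : ∀ N : ℕ, 0 < N → ψ (r - (r - p) / N) - ψ p ≤ φ r - φ p := by
    intro N hN
    have hN' : (0 : ℝ) < N := by exact_mod_cast hN
    set δ := (r - p) / N with hδ
    have hδ0 : 0 < δ := div_pos (by linarith) hN'
    have hNδ : N * δ = r - p := by rw [hδ]; field_simp
    have hk : ∀ k : ℕ, k ≤ N →
        ψ (p + k * δ - δ) - ψ (p - δ) ≤ φ (p + k * δ) - φ p := by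
      intro k
      induction k with
      | zero => intro _; simp
      | succ k ih =>
        intro hkN
        have ih := ih (by omega)
        have hle : ((k : ℝ) + 1) * δ ≤ N * δ := by
          gcongr; exact_mod_cast hkN
        have hmid := logQuantile_midpoint_le hV hφ hψ hH0 hHV h1 h2
          (x := p + (k + 1) * δ) (y := p + k * δ - δ) (by linarith) (by nlinarith)
        have e1 : (p + (k + 1) * δ + (p + k * δ - δ)) / 2 = p + k * δ := by ring
        rw [e1] at hmid
        push_cast
        have e2 : p + (k + 1) * δ - δ = p + k * δ := by ring
        rw [e2]
        linarith
    have := hk N le_rfl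
    rw [hNδ, add_sub_cancel] at this
    have := hmono (x := p - δ) (y := p) (by linarith) (by linarith)
    linarith
  refine le_of_forall_lt_imp_le_of_dense ?_
  intro s hs
  have hlt : G (s + ψ p) < V * Real.exp r := by
    rw [← not_le, (hψ r hr).2]; linarith
  have htend : Filter.Tendsto (fun N : ℕ => V * Real.exp (r - (r - p) / N)) Filter.atTop
      (nhds (V * Real.exp (r - 0))) := by
    refine Filter.Tendsto.const_mul _ (Real.continuous_exp.continuousAt.tendsto.comp ?_)
    exact tendsto_const_nhds.sub (tendsto_const_div_atTop_nhds_zero_nat _)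
  rw [sub_zero] at htend
  obtain ⟨N, hN, hN0⟩ := ((htend.eventually_const_lt hlt).and (Filter.eventually_gt_atTop 0)).exists
  have hN' : (0 : ℝ) < N := by exact_mod_cast hN0
  have hδ0 : 0 < (r - p) / N := div_pos (by linarith) hN'
  have : s + ψ p ≤ ψ (r - (r - p) / N) := by
    by_contra! h
    exact absurd (((hψ _ (by linarith)).2 _).2 h.le) (not_le.2 hN)
  linarith [tele N hN0]

theorem exists_eq_shift_of_logQuantile {F G H : ℝ → ℝ} {V a b a' b' : ℝ} (hV : 0 < V)
    (hF : Monotone F) (hFc : Continuous F) (ha : F a = 0) (hb : F b = V)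
    (hG : Monotone G) (hGc : Continuous G) (ha' : G a' = 0) (hb' : G b' = V)
    (hF0 : ∀ s, 0 ≤ F s) (hFV : ∀ s, F s ≤ V) (hG0 : ∀ s, 0 ≤ G s) (hGV : ∀ s, G s ≤ V)
    (hH0 : ∀ s, 0 ≤ H s) (hHV : ∀ s, H s ≤ V)
    (h1 : ∀ s t, F s * G t ≤ H ((s + t) / 2) ^ 2)
    (h2 : ∀ s t, (V - F s) * (V - G t) ≤ (V - H ((s + t) / 2)) ^ 2) :
    ∃ c, ∀ s, F s = G (s - c) := by
  obtain ⟨φ, hφ⟩ := exists_isLogQuantile hV hF hFc ha hb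
  obtain ⟨ψ, hψ⟩ := exists_isLogQuantile hV hG hGc ha' hb'
  have hdiff : ∀ x ≤ 0, φ x = ψ x + (φ 0 - ψ 0) := by
    intro x hx
    rcases hx.lt_or_eq with hx | rfl
    · have e1 := logQuantile_sub_le hV hφ hψ hH0 hHV h1 h2 hx le_rfl
      have e2 := logQuantile_sub_le (F := G) (G := F) (H := H) hV hψ hφ hH0 hHV
        (fun s t => by rw [mul_comm, add_comm s t]; exact h1 t s)
        (fun s t => by rw [mul_comm, add_comm s t]; exact h2 t s) hx le_rfl
      linarith
    · ring
  refine ⟨φ 0 - ψ 0, fun s => ?_⟩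
  have hiff : ∀ τ, 0 < τ → τ ≤ V → (τ ≤ F s ↔ τ ≤ G (s - (φ 0 - ψ 0))) := by
    intro τ h0 hle
    have hx : Real.log (τ / V) ≤ 0 := Real.log_nonpos (by positivity) ((div_le_one hV).2 hle)
    have hτ : V * Real.exp (Real.log (τ / V)) = τ := by
      rw [Real.exp_log (by positivity)]; field_simp
    have e1 := (hφ _ hx).2 s
    have e2 := (hψ _ hx).2 (s - (φ 0 - ψ 0))
    rw [hτ] at e1 e2
    rw [e1, e2, hdiff _ hx]
    constructor <;> intro h <;> linarith
  apply le_antisymm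
  · rcases (hF0 s).eq_or_lt with h | h
    · rw [← h]; exact hG0 _
    · exact (hiff _ h (hFV s)).1 le_rfl
  · rcases (hG0 (s - (φ 0 - ψ 0))).eq_or_lt with h | h
    · rw [← h]; exact hF0 _
    · exact (hiff _ h (hGV _)).2 le_rfl

/-- The volume of the part of `A` on which the linear functional `⟪·, u⟫` is at most `s`. -/
def cutVolume {d : ℕ} (A : Set (EuclideanSpace ℝ (Fin d))) (u : EuclideanSpace ℝ (Fin d))
    (s : ℝ) : ℝ := volume.real (A ∩ {x | ⟪x, u⟫ ≤ s})

section CutVolume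

variable {d : ℕ} {A B : Set (EuclideanSpace ℝ (Fin d))} {u : EuclideanSpace ℝ (Fin d)}

theorem measurableSet_inner_le (u : EuclideanSpace ℝ (Fin d)) (s : ℝ) :
    MeasurableSet {x : EuclideanSpace ℝ (Fin d) | ⟪x, u⟫ ≤ s} :=
  (isClosed_le (by fun_prop) continuous_const).measurableSet

theorem measurableSet_lt_inner (u : EuclideanSpace ℝ (Fin d)) (s : ℝ) :
    MeasurableSet {x : EuclideanSpace ℝ (Fin d) | s < ⟪x, u⟫} :=
  (isOpen_lt continuous_const (by fun_prop)).measurableSet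

theorem volume_inner_eq_zero (hu : u ≠ 0) (s : ℝ) :
    volume {x : EuclideanSpace ℝ (Fin d) | ⟪x, u⟫ = s} = 0 := by
  by_cases hne : {x : EuclideanSpace ℝ (Fin d) | ⟪x, u⟫ = s}.Nonempty
  swap
  · rw [Set.not_nonempty_iff_eq_empty.1 hne, measure_empty]
  obtain ⟨p, hp⟩ := hne
  have hp : ⟪p, u⟫ = s := hp
  have heq : {x : EuclideanSpace ℝ (Fin d) | ⟪x, u⟫ = s}
      = ((AffineSubspace.mk' p (ℝ ∙ u)ᗮ : AffineSubspace ℝ _) : Set _) := by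
    ext x
    simp only [SetLike.mem_coe, AffineSubspace.mem_mk', vsub_eq_sub,
      Submodule.mem_orthogonal_singleton_iff_inner_left, inner_sub_left, hp, sub_eq_zero]
    rfl
  rw [heq]
  refine Measure.addHaar_affineSubspace _ _ fun htop => hu ?_
  have : (ℝ ∙ u)ᗮ = ⊤ := by
    have := congrArg AffineSubspace.direction htop
    simpa using this
  have hmem : u ∈ (ℝ ∙ u)ᗮ := by rw [this]; trivial
  rw [Submodule.mem_orthogonal_singleton_iff_inner_left] at hmem
  exact inner_self_eq_zero.1 hmem

theorem cutVolume_mono (hA : volume A ≠ ⊤) : Monotone (cutVolume A u) := fun _ _ hst =>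
  measureReal_mono (Set.inter_subset_inter_right _ fun _ hx => le_trans hx hst)
    (measure_ne_top_of_subset Set.inter_subset_left hA)

theorem cutVolume_nonneg (s : ℝ) : 0 ≤ cutVolume A u s := measureReal_nonneg

theorem cutVolume_le (hA : volume A ≠ ⊤) (s : ℝ) : cutVolume A u s ≤ volume.real A :=
  measureReal_mono Set.inter_subset_left hA

theorem sub_cutVolume (hA : volume A ≠ ⊤) (s : ℝ) :
    volume.real A - cutVolume A u s = volume.real (A ∩ {x | s < ⟪x, u⟫}) := by
  have h := measureReal_inter_add_sdiff (μ := volume) (s := A) (measurableSet_inner_le u s) hA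
  have e : A \ {x | ⟪x, u⟫ ≤ s} = A ∩ {x | s < ⟪x, u⟫} := by
    ext x; simp
  rw [e] at h
  rw [cutVolume]; linarith

theorem cutVolume_eq_of_forall_le {s : ℝ} (h : ∀ x ∈ A, ⟪x, u⟫ ≤ s) :
    cutVolume A u s = volume.real A := by
  rw [cutVolume, Set.inter_eq_left.2 (show A ⊆ {x | ⟪x, u⟫ ≤ s} from h)]

theorem cutVolume_eq_zero_of_forall_lt {s : ℝ} (h : ∀ x ∈ A, s < ⟪x, u⟫) :
    cutVolume A u s = 0 := by
  have : A ∩ {x | ⟪x, u⟫ ≤ s} = ∅ := by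
    ext x
    simp only [Set.mem_inter_iff, Set.mem_ofPred_eq, Set.mem_empty_iff_false, iff_false, not_and,
      not_le]
    exact h x
  rw [cutVolume, this, measureReal_empty]

theorem continuous_cutVolume (hAf : volume A ≠ ⊤) (hu : u ≠ 0) :
    Continuous (cutVolume A u) := by
  have heq : cutVolume A u =
      fun s => ∫ x in A, {x | ⟪x, u⟫ ≤ s}.indicator (fun _ => (1 : ℝ)) x := by
    ext s
    rw [integral_indicator (measurableSet_inner_le u s), Measure.restrict_restrict
      (measurableSet_inner_le u s), setIntegral_const, cutVolume, Set.inter_comm]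
    simp
  rw [heq, continuous_iff_continuousAt]
  intro s₀
  have : IsFiniteMeasure (volume.restrict A) := ⟨by simpa using hAf.lt_top⟩
  refine continuousAt_of_dominated (bound := fun _ => 1) ?_ ?_ (integrable_const 1) ?_
  · exact Filter.Eventually.of_forall fun s =>
      (measurable_const.indicator (measurableSet_inner_le u s)).aestronglyMeasurable
  · refine Filter.Eventually.of_forall fun s => Filter.Eventually.of_forall fun x => ?_
    by_cases hx : x ∈ {x | ⟪x, u⟫ ≤ s}
    · simp [Set.indicator_of_mem hx]
    · simp [Set.indicator_of_notMem hx]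
  · have : ∀ᵐ x ∂(volume.restrict A), ⟪x, u⟫ ≠ s₀ := by
      refine ae_restrict_of_ae ?_
      rw [ae_iff]
      simpa using volume_inner_eq_zero hu s₀
    filter_upwards [this] with x hx
    rcases lt_or_gt_of_ne hx with h | h
    · refine (continuousAt_const (y := (1 : ℝ))).congr ?_
      filter_upwards [lt_mem_nhds h] with s hs
      rw [Set.indicator_of_mem (show x ∈ {x | ⟪x, u⟫ ≤ s} from hs.le)]
    · refine (continuousAt_const (y := (0 : ℝ))).congr ?_
      filter_upwards [gt_mem_nhds h] with s hs
      rw [Set.indicator_of_notMem (show x ∉ {x | ⟪x, u⟫ ≤ s} from not_le.2 hs)]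

theorem exists_cutVolume_eq_shift (hA : IsCompact A) (hB : IsCompact B)
    (hV : 0 < volume.real A) (hAB : volume.real A = volume.real B)
    (hC : volume.real ((1 / 2 : ℝ) • (A + B)) = volume.real A) (hu : u ≠ 0) :
    ∃ c, ∀ s, cutVolume A u s = cutVolume B u (s - c) := by
  have hCc : IsCompact ((1 / 2 : ℝ) • (A + B)) := (hA.add hB).smul _
  have bd : ∀ {D : Set (EuclideanSpace ℝ (Fin d))}, IsCompact D →
      (∃ a, cutVolume D u a = 0) ∧ ∃ b, cutVolume D u b = volume.real D := by
    intro D hD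
    have hcont : ContinuousOn (fun x : EuclideanSpace ℝ (Fin d) => ⟪x, u⟫) D := by fun_prop
    obtain ⟨b, hb⟩ := (hD.image_of_continuousOn hcont).bddAbove
    obtain ⟨a, ha⟩ := (hD.image_of_continuousOn hcont).bddBelow
    refine ⟨⟨a - 1, cutVolume_eq_zero_of_forall_lt fun x hx => ?_⟩,
      ⟨b, cutVolume_eq_of_forall_le fun x hx => hb ⟨x, hx, rfl⟩⟩⟩
    have := ha ⟨x, hx, rfl⟩
    dsimp only at this
    linarith
  obtain ⟨⟨a, ha⟩, b, hb⟩ := bd hA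
  obtain ⟨⟨a', ha'⟩, b', hb'⟩ := bd hB
  have hAf := hA.measure_ne_top (μ := volume)
  have hBf := hB.measure_ne_top (μ := volume)
  have hCf := hCc.measure_ne_top (μ := volume)
  have toReal : ∀ {X Y Z : Set (EuclideanSpace ℝ (Fin d))}, volume Z ≠ ⊤ →
      volume X * volume Y ≤ volume Z ^ 2 →
      volume.real X * volume.real Y ≤ volume.real Z ^ 2 := by
    intro X Y Z hZ h
    simp only [Measure.real]
    rw [← ENNReal.toReal_mul, ← ENNReal.toReal_pow]
    exact ENNReal.toReal_mono (ENNReal.pow_ne_top hZ) h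
  refine exists_eq_shift_of_logQuantile (H := cutVolume ((1 / 2 : ℝ) • (A + B)) u) hV
    (cutVolume_mono hAf) (continuous_cutVolume hAf hu) ha hb
    (cutVolume_mono hBf) (continuous_cutVolume hBf hu) ha'
    (hb'.trans hAB.symm) cutVolume_nonneg (cutVolume_le hAf) cutVolume_nonneg
    (fun s => (cutVolume_le hBf s).trans hAB.ge) cutVolume_nonneg
    (fun s => (cutVolume_le hCf s).trans hC.le) ?_ ?_
  · intro s t
    refine toReal (measure_ne_top_of_subset Set.inter_subset_left hCf)
      (volume_mul_volume_le_sq (hA.measurableSet.inter (measurableSet_inner_le u s))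
      (hB.measurableSet.inter (measurableSet_inner_le u t))
      (hCc.measurableSet.inter (measurableSet_inner_le u _))
      (hA.isBounded.subset Set.inter_subset_left) (hB.isBounded.subset Set.inter_subset_left) ?_)
    rintro x ⟨hx, hxs⟩ y ⟨hy, hyt⟩
    refine ⟨Set.smul_mem_smul_set (Set.add_mem_add hx hy), ?_⟩
    simp only [Set.mem_ofPred_eq] at hxs hyt ⊢
    rw [inner_smul_left, inner_add_left]
    simp only [conj_trivial]
    linarith
  · intro s t
    have e1 := sub_cutVolume (u := u) hAf s
    have e2 := sub_cutVolume (u := u) hBf t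
    have e3 := sub_cutVolume (u := u) hCf ((s + t) / 2)
    rw [hC] at e3
    rw [← hAB] at e2
    rw [e1, e2, e3]
    refine toReal (measure_ne_top_of_subset Set.inter_subset_left hCf)
      (volume_mul_volume_le_sq (hA.measurableSet.inter (measurableSet_lt_inner u s))
      (hB.measurableSet.inter (measurableSet_lt_inner u t))
      (hCc.measurableSet.inter (measurableSet_lt_inner u _))
      (hA.isBounded.subset Set.inter_subset_left) (hB.isBounded.subset Set.inter_subset_left) ?_)
    rintro x ⟨hx, hxs⟩ y ⟨hy, hyt⟩
    refine ⟨Set.smul_mem_smul_set (Set.add_mem_add hx hy), ?_⟩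
    simp only [Set.mem_ofPred_eq] at hxs hyt ⊢
    rw [inner_smul_left, inner_add_left]
    simp only [conj_trivial]
    linarith

theorem integral_inner_of_cutVolume_eq_shift (hA : IsCompact A) (hB : IsCompact B)
    (hAB : volume.real A = volume.real B) {c : ℝ}
    (h : ∀ s, cutVolume A u s = cutVolume B u (s - c)) :
    ∫ x in A, ⟪x, u⟫ = (∫ x in B, ⟪x, u⟫) + c * volume.real A := by
  have : IsFiniteMeasure (volume.restrict A) := ⟨by simpa using hA.measure_lt_top⟩
  have : IsFiniteMeasure (volume.restrict B) := ⟨by simpa using hB.measure_lt_top⟩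
  have hf : Measurable fun x : EuclideanSpace ℝ (Fin d) => ⟪x, u⟫ := by fun_prop
  have hg : Measurable fun x : EuclideanSpace ℝ (Fin d) => ⟪x, u⟫ + c := by fun_prop
  have hmap : (volume.restrict A).map (fun x => ⟪x, u⟫)
      = (volume.restrict B).map (fun x => ⟪x, u⟫ + c) := by
    refine Measure.ext_of_Iic _ _ fun s => ?_
    rw [Measure.map_apply hf measurableSet_Iic, Measure.map_apply hg measurableSet_Iic,
      Measure.restrict_apply (hf measurableSet_Iic), Measure.restrict_apply (hg measurableSet_Iic)]
    have e1 : (fun x : EuclideanSpace ℝ (Fin d) => ⟪x, u⟫) ⁻¹' Set.Iic s ∩ A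
        = A ∩ {x | ⟪x, u⟫ ≤ s} := by rw [Set.inter_comm]; rfl
    have e2 : (fun x : EuclideanSpace ℝ (Fin d) => ⟪x, u⟫ + c) ⁻¹' Set.Iic s ∩ B
        = B ∩ {x | ⟪x, u⟫ ≤ s - c} := by
      ext x
      simp only [Set.mem_inter_iff, Set.mem_preimage, Set.mem_Iic, Set.mem_ofPred_eq, le_sub_iff_add_le]
      tauto
    rw [e1, e2]
    exact (measureReal_eq_measureReal_iff
      (measure_ne_top_of_subset Set.inter_subset_left hA.measure_ne_top)
      (measure_ne_top_of_subset Set.inter_subset_left hB.measure_ne_top)).1 (h s)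
  have e1 : ∫ x in A, ⟪x, u⟫ = ∫ y, y ∂((volume.restrict A).map (fun x => ⟪x, u⟫)) :=
    (integral_map hf.aemeasurable aestronglyMeasurable_id).symm
  have e2 : ∫ x in B, (⟪x, u⟫ + c) = ∫ y, y ∂((volume.restrict B).map (fun x => ⟪x, u⟫ + c)) :=
    (integral_map hg.aemeasurable aestronglyMeasurable_id).symm
  rw [e1, hmap, ← e2, integral_add _ (integrable_const c), integral_const]
  · rw [hAB]
    simp [mul_comm]
  · exact (ContinuousOn.integrableOn_compact hB (by fun_prop))

theorem subset_vadd_of_cutVolume_eq_shift (hA : Convex ℝ A) (hAc : IsCompact A)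
    (hAi : (interior A).Nonempty) (hB : Convex ℝ B) (hBc : IsCompact B)
    (hAB : volume.real A = volume.real B) (g : EuclideanSpace ℝ (Fin d))
    (h : ∀ u ≠ 0, ∀ s, cutVolume A u s = cutVolume B u (s - ⟪g, u⟫)) : A ⊆ g +ᵥ B := by
  intro x hx
  by_contra hxB
  obtain ⟨f, r, hfB, hfx⟩ := geometric_hahn_banach_closed_point (hB.vadd g)
    (hBc.vadd g).isClosed hxB
  set u := (InnerProductSpace.toDual ℝ (EuclideanSpace ℝ (Fin d))).symm f with hu
  have hfu : ∀ y, f y = ⟪y, u⟫ := fun y => by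
    rw [real_inner_comm, hu, InnerProductSpace.toDual_symm_apply]
  have hVA : 0 < volume.real A := by
    refine ENNReal.toReal_pos ?_ hAc.measure_ne_top
    exact (Measure.measure_pos_of_nonempty_interior volume hAi).ne'
  have hBne : B.Nonempty := by
    rw [Set.nonempty_iff_ne_empty]
    rintro rfl
    rw [hAB, measureReal_empty] at hVA
    exact hVA.false
  have hu0 : u ≠ 0 := by
    intro h0
    obtain ⟨b, hb⟩ := hBne
    have h1 := hfB (g +ᵥ b) (Set.vadd_mem_vadd_set hb)
    rw [hfu, h0, inner_zero_right] at h1 hfx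
    linarith
  have e1 : cutVolume B u (r - ⟪g, u⟫) = volume.real B := by
    refine cutVolume_eq_of_forall_le fun b hb => ?_
    have h1 := hfB (g +ᵥ b) (Set.vadd_mem_vadd_set hb)
    rw [hfu, vadd_eq_add, inner_add_left] at h1
    linarith
  have e2 := sub_cutVolume (u := u) (hAc.measure_ne_top (μ := volume)) r
  rw [h u hu0, e1, hAB, sub_self] at e2
  have hxcl : x ∈ closure (interior A) := by
    rw [hA.closure_interior_eq_closure_of_nonempty_interior hAi]
    exact subset_closure hx
  have hopen : IsOpen {y : EuclideanSpace ℝ (Fin d) | r < ⟪y, u⟫} :=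
    isOpen_lt continuous_const (by fun_prop)
  obtain ⟨y, hy1, hy2⟩ := mem_closure_iff.1 hxcl _ hopen (by rw [hfu] at hfx; exact hfx)
  have hpos : 0 < volume (interior A ∩ {y | r < ⟪y, u⟫}) :=
    (isOpen_interior.inter hopen).measure_pos _ ⟨y, hy2, hy1⟩
  have hpos' : 0 < volume (A ∩ {y | r < ⟪y, u⟫}) :=
    hpos.trans_le (measure_mono (Set.inter_subset_inter_left _ interior_subset))
  exact (ENNReal.toReal_pos hpos'.ne'
    (measure_ne_top_of_subset Set.inter_subset_left hAc.measure_ne_top)).ne e2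

theorem exists_eq_vadd_of_volume_midpoint_eq (hA : Convex ℝ A) (hAc : IsCompact A)
    (hAi : (interior A).Nonempty) (hB : Convex ℝ B) (hBc : IsCompact B)
    (hBi : (interior B).Nonempty) (hAB : volume.real A = volume.real B)
    (hC : volume.real ((1 / 2 : ℝ) • (A + B)) = volume.real A) :
    ∃ g : EuclideanSpace ℝ (Fin d), A = g +ᵥ B := by
  have hVA : 0 < volume.real A := by
    refine ENNReal.toReal_pos ?_ hAc.measure_ne_top
    exact (Measure.measure_pos_of_nonempty_interior volume hAi).ne'
  set g : EuclideanSpace ℝ (Fin d) := (volume.real A)⁻¹ • ((∫ x in A, x) - ∫ x in B, x) with hg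
  have hcenter : ∀ {D : Set (EuclideanSpace ℝ (Fin d))}, IsCompact D → ∀ u,
      ⟪∫ x in D, x, u⟫ = ∫ x in D, ⟪x, u⟫ := by
    intro D hD u
    have hi : IntegrableOn (fun x : EuclideanSpace ℝ (Fin d) => x) D :=
      ContinuousOn.integrableOn_compact hD (by fun_prop)
    rw [real_inner_comm, ← integral_inner hi]
    simp only [real_inner_comm]
  have key : ∀ u ≠ 0, ∀ s, cutVolume A u s = cutVolume B u (s - ⟪g, u⟫) := by
    intro u hu
    obtain ⟨c, hc⟩ := exists_cutVolume_eq_shift hAc hBc hVA hAB hC hu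
    have h1 := integral_inner_of_cutVolume_eq_shift hAc hBc hAB hc
    have h2 : ⟪g, u⟫ = c := by
      rw [hg, inner_smul_left, inner_sub_left, hcenter hAc, hcenter hBc, h1]
      simp only [conj_trivial]
      field_simp
      ring
    rw [h2]; exact hc
  refine ⟨g, (subset_vadd_of_cutVolume_eq_shift hA hAc hAi hB hBc hAB g key).antisymm ?_⟩
  have := subset_vadd_of_cutVolume_eq_shift hB hBc hBi hA hAc hAB.symm (-g)
    (fun u hu s => by rw [key u hu, inner_neg_left]; congr 1; ring)
  intro x hx
  obtain ⟨b, hb, rfl⟩ := hx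
  obtain ⟨a, ha, rfl⟩ := this hb
  simpa using ha

end CutVolume

section PolytopeFaces

variable {d : ℕ} {P : Set (EuclideanSpace ℝ (Fin d))} {V : Finset (EuclideanSpace ℝ (Fin d))}
  {u v : EuclideanSpace ℝ (Fin d)}

/-- The support function of `P`. -/
def supportFn (P : Set (EuclideanSpace ℝ (Fin d))) (u : EuclideanSpace ℝ (Fin d)) : ℝ :=
  sSup ((fun x => ⟪x, u⟫) '' P)

/-- The unit outer normal vectors of the facets of `P`. -/
def facetNormals (P : Set (EuclideanSpace ℝ (Fin d))) : Set (EuclideanSpace ℝ (Fin d)) :=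
  {u | ‖u‖ = 1 ∧ Module.finrank ℝ (vectorSpan ℝ (normalFace P u)) = d - 1}

theorem inner_le_supportFn (hP : IsCompact P) {x : EuclideanSpace ℝ (Fin d)} (hx : x ∈ P) :
    ⟪x, u⟫ ≤ supportFn P u :=
  le_csSup (hP.image_of_continuousOn
    (f := fun x : EuclideanSpace ℝ (Fin d) => ⟪x, u⟫) (by fun_prop)).bddAbove ⟨x, hx, rfl⟩

theorem exists_mem_inner_eq_supportFn (hP : IsCompact P) (hne : P.Nonempty)
    (u : EuclideanSpace ℝ (Fin d)) : ∃ x ∈ P, ⟪x, u⟫ = supportFn P u := by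
  have := (hP.image_of_continuousOn
    (f := fun x : EuclideanSpace ℝ (Fin d) => ⟪x, u⟫) (by fun_prop)).sSup_mem (hne.image _)
  exact this

theorem normalFace_eq_inter (hP : IsCompact P) (hne : P.Nonempty)
    (u : EuclideanSpace ℝ (Fin d)) :
    normalFace P u = P ∩ {x | ⟪x, u⟫ = supportFn P u} := by
  ext x
  constructor
  · rintro ⟨hx, h⟩
    obtain ⟨y, hy, hyu⟩ := exists_mem_inner_eq_supportFn hP hne u
    exact ⟨hx, le_antisymm (inner_le_supportFn hP hx) (hyu ▸ h y hy)⟩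
  · rintro ⟨hx, h⟩
    exact ⟨hx, fun y hy => (inner_le_supportFn hP hy).trans (le_of_eq (Eq.symm h))⟩

theorem normalFace_nonempty (hP : IsCompact P) (hne : P.Nonempty)
    (u : EuclideanSpace ℝ (Fin d)) : (normalFace P u).Nonempty := by
  obtain ⟨x, hx, h⟩ := exists_mem_inner_eq_supportFn hP hne u
  rw [normalFace_eq_inter hP hne]
  exact ⟨x, hx, h⟩

theorem normalFace_smul (P : Set (EuclideanSpace ℝ (Fin d))) {c : ℝ} (hc : 0 < c)
    (u : EuclideanSpace ℝ (Fin d)) : normalFace P (c • u) = normalFace P u := by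
  ext x
  simp only [normalFace, Set.mem_ofPred_eq, inner_smul_right, mul_le_mul_iff_right₀ hc]

theorem vectorSpan_normalFace_le (P : Set (EuclideanSpace ℝ (Fin d)))
    (u : EuclideanSpace ℝ (Fin d)) : vectorSpan ℝ (normalFace P u) ≤ (ℝ ∙ u)ᗮ := by
  rw [vectorSpan_def, Submodule.span_le]
  rintro _ ⟨x, hx, y, hy, rfl⟩
  simp only [SetLike.mem_coe, Submodule.mem_orthogonal_singleton_iff_inner_left, vsub_eq_sub,
    inner_sub_left, sub_eq_zero]
  exact le_antisymm (hy.2 x hx.1) (hx.2 y hy.1)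

theorem finrank_orthogonal_span (hu : u ≠ 0) : Module.finrank ℝ (ℝ ∙ u)ᗮ = d - 1 := by
  have h1 := Submodule.finrank_add_finrank_orthogonal (ℝ ∙ u)
  rw [finrank_span_singleton hu, finrank_euclideanSpace_fin] at h1
  omega

theorem eq_norm_smul_of_normalFace_eq (hP : IsCompact P) (hPi : (interior P).Nonempty)
    (hu : u ∈ facetNormals P) (hv : v ≠ 0) (h : normalFace P u = normalFace P v) :
    v = ‖v‖ • u := by
  have hu0 : u ≠ 0 := by
    rintro rfl
    simpa using hu.1
  have hne : P.Nonempty := hPi.mono interior_subset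
  have e1 : vectorSpan ℝ (normalFace P u) = (ℝ ∙ u)ᗮ :=
    Submodule.eq_of_le_of_finrank_eq (vectorSpan_normalFace_le P u)
      (hu.2.trans (finrank_orthogonal_span hu0).symm)
  have e2 : vectorSpan ℝ (normalFace P u) = (ℝ ∙ v)ᗮ :=
    Submodule.eq_of_le_of_finrank_eq (h ▸ vectorSpan_normalFace_le P v)
      (hu.2.trans (finrank_orthogonal_span hv).symm)
  have e3 : (ℝ ∙ v) = ℝ ∙ u := by
    rw [← Submodule.orthogonal_orthogonal (ℝ ∙ v), ← e2, e1, Submodule.orthogonal_orthogonal]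
  obtain ⟨c, hc⟩ := Submodule.mem_span_singleton.1 (e3 ▸ Submodule.mem_span_singleton_self v)
  have hc0 : 0 ≤ c := by
    by_contra! hneg
    obtain ⟨p, hp⟩ := normalFace_nonempty hP hne u
    have hp' := hp
    rw [h] at hp'
    have hsub : P ⊆ {x | ⟪x, u⟫ = ⟪p, u⟫} := by
      intro x hx
      have h1 := hp.2 x hx
      have h2 := hp'.2 x hx
      rw [← hc, inner_smul_right, inner_smul_right] at h2
      exact le_antisymm h1 (by nlinarith)
    have h0 := measure_mono_null (interior_subset.trans hsub) (volume_inner_eq_zero hu0 _)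
    exact (isOpen_interior.measure_pos volume hPi).ne' h0
  rw [← hc, norm_smul, hu.1, mul_one, Real.norm_of_nonneg hc0]

theorem normalFace_convexHull_subset [DecidablePred (· ∈ normalFace (convexHull ℝ (V : Set _)) u)] :
    normalFace (convexHull ℝ (V : Set _)) u ⊆
      convexHull ℝ ((V.filter (· ∈ normalFace (convexHull ℝ (V : Set _)) u) : Finset _) :
        Set (EuclideanSpace ℝ (Fin d))) := by
  intro x hx
  obtain ⟨w, hw0, hw1, hwx⟩ := Finset.mem_convexHull'.1 hx.1
  have hzero : ∀ y ∈ V, y ∉ normalFace (convexHull ℝ (V : Set _)) u → w y = 0 := by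
    intro y hy hyF
    have hsum : ∑ y ∈ V, w y * (⟪x, u⟫ - ⟪y, u⟫) = 0 := by
      simp only [mul_sub, Finset.sum_sub_distrib, ← Finset.sum_mul, hw1, one_mul]
      nth_rw 1 [← hwx]
      simp only [sum_inner, inner_smul_left, conj_trivial, sub_self]
    have hnn : ∀ y ∈ V, 0 ≤ w y * (⟪x, u⟫ - ⟪y, u⟫) := fun y hy =>
      mul_nonneg (hw0 y hy) (sub_nonneg.2 (hx.2 y (subset_convexHull ℝ _ hy)))
    rcases mul_eq_zero.1 ((Finset.sum_eq_zero_iff_of_nonneg hnn).1 hsum y hy) with h | h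
    · exact h
    · refine absurd ⟨subset_convexHull ℝ _ hy, fun z hz => ?_⟩ hyF
      rw [← sub_eq_zero.1 h]
      exact hx.2 z hz
  refine Finset.mem_convexHull'.2 ⟨w, fun y hy => hw0 y (Finset.mem_filter.1 hy).1, ?_, ?_⟩
  · rw [← hw1]
    exact Finset.sum_filter_of_ne fun y hy h => by
      by_contra hF; exact h (hzero y hy hF)
  · rw [← hwx]
    exact Finset.sum_filter_of_ne fun y hy h => by
      by_contra hF; exact h (by rw [hzero y hy hF, zero_smul])

theorem convex_normalFace (hP : Convex ℝ P) (u : EuclideanSpace ℝ (Fin d)) :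
    Convex ℝ (normalFace P u) := by
  intro x hx y hy a b ha hb hab
  refine ⟨hP hx.1 hy.1 ha hb hab, fun z hz => ?_⟩
  have h1 := hx.2 z hz
  have h2 := hy.2 z hz
  rw [inner_add_left, inner_smul_left, inner_smul_left]
  simp only [conj_trivial]
  calc ⟪z, u⟫ = a * ⟪z, u⟫ + b * ⟪z, u⟫ := by rw [← add_mul, hab, one_mul]
    _ ≤ _ := by gcongr

theorem finite_facetNormals (hi : (interior (convexHull ℝ (V : Set (EuclideanSpace ℝ (Fin d))))).Nonempty) :
    (facetNormals (convexHull ℝ (V : Set (EuclideanSpace ℝ (Fin d))))).Finite := by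
  classical
  set P := convexHull ℝ (V : Set (EuclideanSpace ℝ (Fin d))) with hPdef
  have hPc : IsCompact P := V.finite_toSet.isCompact_convexHull ℝ
  refine Set.Finite.of_injOn (f := fun u => V.filter (· ∈ normalFace P u))
    (t := (V.powerset : Set (Finset (EuclideanSpace ℝ (Fin d))))) ?_ ?_ (Finset.finite_toSet _)
  · intro u _
    exact Finset.mem_coe.2 (Finset.mem_powerset.2 (Finset.filter_subset _ _))
  · intro u hu v hv huv
    have hF : ∀ w, normalFace P w = convexHull ℝ
        ((V.filter (· ∈ normalFace P w) : Finset _) : Set (EuclideanSpace ℝ (Fin d))) := by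
      intro w
      refine normalFace_convexHull_subset.antisymm (convexHull_min ?_
        (convex_normalFace (convex_convexHull ℝ _) w))
      intro x hx
      exact (Finset.mem_filter.1 hx).2
    have heq : normalFace P u = normalFace P v := by
      rw [hF u, hF v]
      simp only at huv
      rw [huv]
    have hv0 : v ≠ 0 := by
      rintro rfl
      simpa using hv.1
    have := eq_norm_smul_of_normalFace_eq hPc hi hu hv0 heq
    rw [hv.1, one_smul] at this
    exact this.symm

theorem exists_facetNormal_of_notMem (hi : (interior (convexHull ℝ (V : Set (EuclideanSpace ℝ (Fin d))))).Nonempty)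
    {x : EuclideanSpace ℝ (Fin d)} (hx : x ∉ convexHull ℝ (V : Set _)) :
    ∃ u ∈ facetNormals (convexHull ℝ (V : Set (EuclideanSpace ℝ (Fin d)))),
      supportFn (convexHull ℝ (V : Set (EuclideanSpace ℝ (Fin d)))) u < ⟪x, u⟫ := by
  classical
  set P := convexHull ℝ (V : Set (EuclideanSpace ℝ (Fin d))) with hPdef
  have hPc : IsCompact P := V.finite_toSet.isCompact_convexHull ℝ
  have hPconv : Convex ℝ P := convex_convexHull ℝ _
  have hne : P.Nonempty := hi.mono interior_subset
  obtain ⟨y, hyP, hy⟩ : ∃ y ∈ interior P, ∀ W : Finset (EuclideanSpace ℝ (Fin d)),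
      W ⊆ V →
      y ∈ affineSpan ℝ (insert x (W : Set (EuclideanSpace ℝ (Fin d)))) →
      affineSpan ℝ (insert x (W : Set (EuclideanSpace ℝ (Fin d)))) = ⊤ := by
    by_contra! hcon
    have hsub : interior P ⊆ ⋃ W ∈ V.powerset.filter
        (fun W : Finset (EuclideanSpace ℝ (Fin d)) => affineSpan ℝ (insert x (W : Set (EuclideanSpace ℝ (Fin d)))) ≠ ⊤),
        (affineSpan ℝ (insert x (W : Set (EuclideanSpace ℝ (Fin d)))) :
          Set (EuclideanSpace ℝ (Fin d))) := by
      intro y hy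
      obtain ⟨W, hW, hyW, hWt⟩ := hcon y hy
      simp only [Set.mem_iUnion, Finset.mem_filter, Finset.mem_powerset]
      exact ⟨W, ⟨hW, hWt⟩, hyW⟩
    have h0 : volume (⋃ W ∈ V.powerset.filter
        (fun W : Finset (EuclideanSpace ℝ (Fin d)) => affineSpan ℝ (insert x (W : Set (EuclideanSpace ℝ (Fin d)))) ≠ ⊤),
        (affineSpan ℝ (insert x (W : Set (EuclideanSpace ℝ (Fin d)))) :
          Set (EuclideanSpace ℝ (Fin d)))) = 0 := by
      refine (measure_biUnion_null_iff (Finset.countable_toSet _)).2 ?_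
      intro W hW
      exact Measure.addHaar_affineSubspace _ _ (Finset.mem_filter.1 hW).2
    exact (isOpen_interior.measure_pos volume hi).ne' (measure_mono_null hsub h0)
  set T : Set ℝ := Set.Icc 0 1 ∩ (fun t : ℝ => x + t • (y - x)) ⁻¹' P with hT
  have hTc : IsClosed T := isClosed_Icc.inter (hPc.isClosed.preimage (by fun_prop))
  have h1T : (1 : ℝ) ∈ T := ⟨by simp, by simpa using interior_subset hyP⟩
  have hTb : BddBelow T := ⟨0, fun t ht => ht.1.1⟩
  set t₀ := sInf T with ht₀
  have htT : t₀ ∈ T := hTc.csInf_mem ⟨1, h1T⟩ hTb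
  have ht0 : 0 < t₀ := by
    refine lt_of_le_of_ne htT.1.1 fun h => hx ?_
    simpa [← h] using htT.2
  set z := x + t₀ • (y - x) with hz
  have hzP : z ∈ P := htT.2
  have hzi : z ∉ interior P := by
    intro hzi
    have hnear : ∀ᶠ t in nhdsWithin t₀ (Set.Iio t₀), x + t • (y - x) ∈ interior P ∧ 0 < t := by
      refine nhdsWithin_le_nhds (Filter.Eventually.and ?_ (lt_mem_nhds ht0))
      have hc : Continuous fun t : ℝ => x + t • (y - x) := by fun_prop
      exact hc.continuousAt.eventually_mem (isOpen_interior.mem_nhds hzi)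
    obtain ⟨t, ⟨htP, htpos⟩, htlt⟩ := (hnear.and self_mem_nhdsWithin).exists
    have htlt : t < t₀ := htlt
    exact absurd (csInf_le hTb (show t ∈ T from
      ⟨⟨htpos.le, htlt.le.trans htT.1.2⟩, interior_subset (s := P) htP⟩)) (not_le.2 htlt)
  have ht1 : t₀ < 1 := by
    refine lt_of_le_of_ne htT.1.2 fun h => hzi ?_
    rw [hz, h]
    simpa using hyP
  obtain ⟨f, hf⟩ := geometric_hahn_banach_open_point hPconv.interior isOpen_interior hzi
  set v := (InnerProductSpace.toDual ℝ (EuclideanSpace ℝ (Fin d))).symm f with hv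
  have hfv : ∀ y, f y = ⟪y, v⟫ := fun y => by
    rw [real_inner_comm, hv, InnerProductSpace.toDual_symm_apply]
  simp only [hfv] at hf
  have hv0 : v ≠ 0 := by
    intro h
    have := hf y hyP
    simp [h] at this
  have hzF : z ∈ normalFace P v := by
    refine ⟨hzP, fun a ha => ?_⟩
    have hacl : a ∈ closure (interior P) := by
      rw [hPconv.closure_interior_eq_closure_of_nonempty_interior hi]
      exact subset_closure ha
    have hcl : IsClosed {a : EuclideanSpace ℝ (Fin d) | ⟪a, v⟫ ≤ ⟪z, v⟫} :=
      isClosed_le (by fun_prop) continuous_const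
    exact closure_minimal (fun b hb => (hf b hb).le) hcl hacl
  have hxv : ⟪z, v⟫ < ⟪x, v⟫ := by
    have h1 := hf y hyP
    have h2 : ⟪z, v⟫ = ⟪x, v⟫ + t₀ * (⟪y, v⟫ - ⟪x, v⟫) := by
      rw [hz, inner_add_left, inner_smul_left, inner_sub_left]; simp
    nlinarith
  have hnv : 0 < ‖v‖ := norm_pos_iff.2 hv0
  refine ⟨‖v‖⁻¹ • v, ⟨by rw [norm_smul, norm_inv, norm_norm, inv_mul_cancel₀ hnv.ne'], ?_⟩, ?_⟩
  · rw [normalFace_smul P (inv_pos.2 hnv)]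
    refine le_antisymm ((Submodule.finrank_mono (vectorSpan_normalFace_le P v)).trans
      (finrank_orthogonal_span hv0).le) ?_
    set W := V.filter (· ∈ normalFace P v) with hW
    have hzW : z ∈ convexHull ℝ (W : Set (EuclideanSpace ℝ (Fin d))) :=
      normalFace_convexHull_subset hzF
    have hyW : y ∈ affineSpan ℝ (insert x (W : Set (EuclideanSpace ℝ (Fin d)))) := by
      have hxm : x ∈ affineSpan ℝ (insert x (W : Set (EuclideanSpace ℝ (Fin d)))) :=
        subset_affineSpan ℝ _ (Set.mem_insert _ _)
      have hzm : z ∈ affineSpan ℝ (insert x (W : Set (EuclideanSpace ℝ (Fin d)))) :=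
        affineSpan_mono ℝ (Set.subset_insert _ _) (convexHull_subset_affineSpan _ hzW)
      have hyl : y = AffineMap.lineMap x z t₀⁻¹ := by
        rw [AffineMap.lineMap_apply, hz]
        simp only [vsub_eq_sub, add_sub_cancel_left, vadd_eq_add, smul_smul,
          inv_mul_cancel₀ ht0.ne', one_smul, sub_add_cancel]
      rw [hyl]
      exact AffineMap.lineMap_mem _ hxm hzm
    have htop := hy W (Finset.filter_subset _ _) hyW
    have hr := finrank_vectorSpan_insert_le_set ℝ (W : Set (EuclideanSpace ℝ (Fin d))) x
    rw [← direction_affineSpan ℝ (insert x (W : Set (EuclideanSpace ℝ (Fin d)))), htop,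
      AffineSubspace.direction_top, finrank_top, finrank_euclideanSpace_fin] at hr
    have hmono : vectorSpan ℝ (W : Set (EuclideanSpace ℝ (Fin d))) ≤
        vectorSpan ℝ (normalFace P v) :=
      vectorSpan_mono ℝ fun a ha => (Finset.mem_filter.1 ha).2
    have := Submodule.finrank_mono hmono
    omega
  · obtain ⟨a, ha, hav⟩ := exists_mem_inner_eq_supportFn hPc hne (‖v‖⁻¹ • v)
    rw [← hav, inner_smul_right, inner_smul_right]
    exact mul_lt_mul_of_pos_left ((hzF.2 a ha).trans_lt hxv) (inv_pos.2 hnv)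

end PolytopeFaces

section Slicing

variable {n : ℕ} {P : Set (EuclideanSpace ℝ (Fin (n + 1)))}
  {u : EuclideanSpace ℝ (Fin (n + 1))}

theorem volume_eq_lintegral_slice (hu : ‖u‖ = 1) {S : Set (EuclideanSpace ℝ (Fin (n + 1)))}
    (hS : MeasurableSet S) : volume S = ∫⁻ r : ℝ, μHE[n] (S ∩ {x | ⟪x, u⟫ = r}) := by
  have hu0 : u ≠ 0 := by
    rintro rfl
    simp at hu
  have h := EuclideanGeometry.euclideanHausdorffMeasure_eq_lintegral
    (0 : EuclideanSpace ℝ (Fin (n + 1))) hu0 hS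
  rw [finrank_euclideanSpace_fin, EuclideanSpace.euclideanHausdorffMeasure_eq_volume,
    ← ofReal_norm, hu, ENNReal.ofReal_one, one_mul, Nat.add_sub_cancel] at h
  rw [h]
  refine lintegral_congr fun r => ?_
  congr 2
  ext x
  simp only [SetLike.mem_coe, AffineSubspace.mem_mk', vsub_eq_sub, vadd_eq_add, add_zero,
    Submodule.mem_orthogonal_singleton_iff_inner_left, inner_sub_left, inner_smul_left,
    conj_trivial, real_inner_self_eq_norm_sq, hu, one_pow, mul_one, sub_eq_zero, Set.mem_ofPred_eq]

theorem euclideanHausdorffMeasure_inter_hyperplane_lt_top (hu : ‖u‖ = 1) (r : ℝ)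
    {S : Set (EuclideanSpace ℝ (Fin (n + 1)))} (hS : Bornology.IsBounded S) :
    μHE[n] (S ∩ {x | ⟪x, u⟫ = r}) < ⊤ := by
  have hu0 : u ≠ 0 := by
    rintro rfl
    simp at hu
  have hfr : Module.finrank ℝ (ℝ ∙ u)ᗮ = n := by
    rw [finrank_orthogonal_span hu0, Nat.add_sub_cancel]
  have hiso : Isometry (fun w : (ℝ ∙ u)ᗮ => r • u + (w : EuclideanSpace ℝ (Fin (n + 1)))) :=
    (isometry_add_left (r • u)).comp isometry_subtype_coe
  set T : Set (ℝ ∙ u)ᗮ :=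
    (fun w : (ℝ ∙ u)ᗮ => r • u + (w : EuclideanSpace ℝ (Fin (n + 1)))) ⁻¹' S with hT
  have hTb : Bornology.IsBounded T := hiso.antilipschitz.isBounded_preimage hS
  have hsub : S ∩ {x | ⟪x, u⟫ = r} ⊆
      (fun w : (ℝ ∙ u)ᗮ => r • u + (w : EuclideanSpace ℝ (Fin (n + 1)))) '' T := by
    rintro x ⟨hx, hxr⟩
    have hxr : ⟪x, u⟫ = r := hxr
    have hmem : x - r • u ∈ (ℝ ∙ u)ᗮ := by
      rw [Submodule.mem_orthogonal_singleton_iff_inner_left, inner_sub_left, inner_smul_left,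
        real_inner_self_eq_norm_sq, hu, hxr]
      simp
    refine ⟨⟨x - r • u, hmem⟩, ?_, ?_⟩
    · simpa [hT] using hx
    · simp
  refine (measure_mono hsub).trans_lt ?_
  rw [hiso.euclideanHausdorffMeasure_image]
  have := InnerProductSpace.euclideanHausdorffMeasure_eq_volume (V := (ℝ ∙ u)ᗮ)
  rw [hfr] at this
  rw [this]
  exact hTb.measure_lt_top

theorem tendsto_measure_hyperplane_inter_cthickening (hu : ‖u‖ = 1) (hP : IsCompact P) (r : ℝ) :
    Filter.Tendsto (fun δ => μHE[n] (Metric.cthickening δ P ∩ {x | ⟪x, u⟫ = r})) (nhds 0)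
      (nhds (μHE[n] (P ∩ {x | ⟪x, u⟫ = r}))) := by
  have h := tendsto_measure_cthickening_of_isClosed
    (μ := (μHE[n] : Measure (EuclideanSpace ℝ (Fin (n + 1)))).restrict {x | ⟪x, u⟫ = r}) (s := P)
    ⟨1, one_pos, by
      rw [Measure.restrict_apply Metric.isClosed_cthickening.measurableSet]
      exact (euclideanHausdorffMeasure_inter_hyperplane_lt_top hu r
        hP.isBounded.cthickening).ne⟩ hP.isClosed
  simpa only [Measure.restrict_apply Metric.isClosed_cthickening.measurableSet,
    Measure.restrict_apply hP.measurableSet] using h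

theorem volume_slab_le (hu : ‖u‖ = 1) {S T : Set (EuclideanSpace ℝ (Fin (n + 1)))} {h k : ℝ}
    (hS : MeasurableSet S) (hSlab : ∀ x ∈ S, h < ⟪x, u⟫ ∧ ⟪x, u⟫ ≤ h + k)
    (hT : ∀ x ∈ S, x - (⟪x, u⟫ - h) • u ∈ T) :
    volume S ≤ ENNReal.ofReal k * μHE[n] (T ∩ {x | ⟪x, u⟫ = h}) := by
  rw [volume_eq_lintegral_slice hu hS]
  calc ∫⁻ r : ℝ, μHE[n] (S ∩ {x | ⟪x, u⟫ = r})
      ≤ ∫⁻ r : ℝ, (Set.Ioc h (h + k)).indicator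
          (fun _ => μHE[n] (T ∩ {x | ⟪x, u⟫ = h})) r := by
        refine lintegral_mono fun r => ?_
        by_cases hr : r ∈ Set.Ioc h (h + k)
        · simp only [Set.indicator_of_mem hr]
          rw [← measure_vadd μHE[n] ((r - h) • u) (T ∩ {x | ⟪x, u⟫ = h})]
          refine measure_mono ?_
          rintro x ⟨hx, hxr⟩
          have hxr : ⟪x, u⟫ = r := hxr
          refine ⟨x - (r - h) • u, ⟨hxr ▸ hT x hx, ?_⟩, by simp⟩
          simp only [Set.mem_ofPred_eq, inner_sub_left, inner_smul_left, conj_trivial,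
            real_inner_self_eq_norm_sq, hu, hxr]
          ring
        · simp only [Set.indicator_of_notMem hr, nonpos_iff_eq_zero]
          refine measure_mono_null (t := ∅) ?_ measure_empty
          rintro x ⟨hx, hxr⟩
          have hxr : ⟪x, u⟫ = r := hxr
          exact hr ⟨hxr ▸ (hSlab x hx).1, hxr ▸ (hSlab x hx).2⟩
    _ = ENNReal.ofReal k * μHE[n] (T ∩ {x | ⟪x, u⟫ = h}) := by
        rw [lintegral_indicator measurableSet_Ioc, setLIntegral_const, Real.volume_Ioc, mul_comm]
        congr 2
        ring

theorem lintegral_cone_profile {m k : ℝ} (hk : 0 < k) (a : ENNReal) (ha : a ≠ ⊤) :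
    ∫⁻ r in Set.Ioc m (m + k), ENNReal.ofReal ((r - m) / k) ^ n * a
      = ENNReal.ofReal (k / (n + 1)) * a := by
  rw [lintegral_mul_const' _ _ ha]
  congr 1
  have h1 : ∫ r in m..(m + k), ((r - m) / k) ^ n = k / (n + 1) := by
    rw [intervalIntegral.integral_comp_sub_right (fun r => (r / k) ^ n),
      intervalIntegral.integral_comp_div (fun r => r ^ n) hk.ne']
    simp only [sub_self, zero_div, add_sub_cancel_left, div_self hk.ne', integral_pow, one_pow,
      smul_eq_mul]
    simp [div_eq_mul_inv]
  rw [← h1, intervalIntegral.integral_of_le (by linarith), ofReal_integral_eq_lintegral_ofReal]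
  · refine setLIntegral_congr_fun measurableSet_Ioc fun r hr => ?_
    rw [ENNReal.ofReal_pow (div_nonneg (by linarith [hr.1]) hk.le)]
  · exact (Continuous.integrableOn_Ioc (by fun_prop))
  · filter_upwards [ae_restrict_mem measurableSet_Ioc] with r hr
    exact pow_nonneg (div_nonneg (by linarith [hr.1]) hk.le) _

theorem ofReal_mul_le_volume_of_homothety_subset (hu : ‖u‖ = 1)
    {S F : Set (EuclideanSpace ℝ (Fin (n + 1)))} {x₀ : EuclideanSpace ℝ (Fin (n + 1))} {h : ℝ}
    (hS : MeasurableSet S) (hF : ∀ y ∈ F, ⟪y, u⟫ = h) (hFb : Bornology.IsBounded F)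
    (hh : ⟪x₀, u⟫ < h)
    (hsub : ∀ ρ ∈ Set.Ioc (0 : ℝ) 1, ∀ y ∈ F, AffineMap.homothety x₀ ρ y ∈ S) :
    ENNReal.ofReal ((h - ⟪x₀, u⟫) / (n + 1)) * μHE[n] F ≤ volume S := by
  set m := ⟪x₀, u⟫ with hm
  have hk : 0 < h - m := by linarith
  have hFf : μHE[n] F ≠ ⊤ := by
    have := euclideanHausdorffMeasure_inter_hyperplane_lt_top hu h hFb
    rwa [Set.inter_eq_left.2 (show F ⊆ {x | ⟪x, u⟫ = h} from hF), lt_top_iff_ne_top] at this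
  rw [volume_eq_lintegral_slice hu hS, ← lintegral_cone_profile (m := m) hk _ hFf,
    ← lintegral_indicator measurableSet_Ioc]
  refine lintegral_mono fun r => ?_
  by_cases hr : r ∈ Set.Ioc m (m + (h - m))
  swap
  · simp only [Set.indicator_of_notMem hr, zero_le]
  simp only [Set.indicator_of_mem hr]
  have hρ0 : 0 < (r - m) / (h - m) := div_pos (by linarith [hr.1]) hk
  have hρ1 : (r - m) / (h - m) ≤ 1 := (div_le_one hk).2 (by linarith [hr.2])
  have him := euclideanHausdorffMeasure_homothety_image n x₀ hρ0.ne' F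
  have hcoe : ENNReal.ofReal ((r - m) / (h - m)) ^ n * μHE[n] F
      = ‖(r - m) / (h - m)‖₊ ^ n • μHE[n] F := by
    rw [ENNReal.smul_def, smul_eq_mul, ENNReal.coe_pow, ← enorm_eq_nnnorm,
      Real.enorm_eq_ofReal hρ0.le]
  rw [hcoe, ← him]
  refine measure_mono ?_
  rintro _ ⟨y, hy, rfl⟩
  refine ⟨hsub _ ⟨hρ0, hρ1⟩ y hy, ?_⟩
  simp only [AffineMap.homothety_apply, vsub_eq_sub, vadd_eq_add, Set.mem_ofPred_eq,
    inner_add_left, inner_smul_left, inner_sub_left, conj_trivial, hF y hy, ← hm]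
  field_simp
  ring

end Slicing

section FacetVolumes

variable {n : ℕ} {V : Finset (EuclideanSpace ℝ (Fin (n + 1)))}
  {P L : Set (EuclideanSpace ℝ (Fin (n + 1)))}

theorem volume_add_smul_le {N : Finset (EuclideanSpace ℝ (Fin (n + 1)))} (hP : IsCompact P)
    (hN : ∀ u ∈ N, ‖u‖ = 1) (hsep : ∀ x ∉ P, ∃ u ∈ N, supportFn P u < ⟪x, u⟫)
    (hL : IsCompact L) {k : EuclideanSpace ℝ (Fin (n + 1)) → ℝ}
    (hk : ∀ u ∈ N, ∀ l ∈ L, ⟪l, u⟫ ≤ k u) {R : ℝ} (hR : ∀ l ∈ L, ‖l‖ ≤ R) {s : ℝ} (hs : 0 ≤ s) :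
    volume (P + s • L) ≤ volume P + ∑ u ∈ N, ENNReal.ofReal (s * k u) *
      μHE[n] (Metric.cthickening (2 * R * s) P ∩ {x | ⟪x, u⟫ = supportFn P u}) := by
  have hQ : IsCompact (P + s • L) := hP.add (hL.smul s)
  have hsub : P + s • L ⊆ P ∪ ⋃ u ∈ N, (P + s • L) ∩ {x | supportFn P u < ⟪x, u⟫} := by
    intro x hx
    by_cases hxP : x ∈ P
    · exact Or.inl hxP
    · obtain ⟨u, hu, hux⟩ := hsep x hxP
      refine Or.inr ?_
      simp only [Set.mem_iUnion]
      exact ⟨u, hu, hx, hux⟩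
  refine (measure_mono hsub).trans ((measure_union_le _ _).trans ?_)
  gcongr
  refine (measure_biUnion_finset_le _ _).trans (Finset.sum_le_sum fun u hu => ?_)
  have hslab : ∀ x ∈ (P + s • L) ∩ {x | supportFn P u < ⟪x, u⟫},
      supportFn P u < ⟪x, u⟫ ∧ ⟪x, u⟫ ≤ supportFn P u + s * k u := by
    rintro x ⟨⟨p, hp, _, ⟨l, hl, rfl⟩, rfl⟩, hx⟩
    refine ⟨hx, ?_⟩
    simp only [inner_add_left, inner_smul_left, conj_trivial]
    have h1 := inner_le_supportFn (u := u) hP hp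
    have h2 := mul_le_mul_of_nonneg_left (hk u hu l hl) hs
    linarith
  refine volume_slab_le (hN u hu) (hQ.measurableSet.inter (measurableSet_lt_inner u _)) hslab ?_
  rintro x ⟨⟨p, hp, _, ⟨l, hl, rfl⟩, rfl⟩, hx⟩
  simp only [Set.mem_ofPred_eq] at hx ⊢
  have hx' := hx
  simp only [inner_add_left, inner_smul_left, conj_trivial] at hx' ⊢
  refine Metric.mem_cthickening_of_dist_le _ p _ _ hp ?_
  have h1 := inner_le_supportFn (u := u) hP hp
  have h2 : ⟪l, u⟫ ≤ R := by
    have := real_inner_le_norm l u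
    rw [hN u hu, mul_one] at this
    exact this.trans (hR l hl)
  have h3 := mul_le_mul_of_nonneg_left h2 hs
  have h4 := mul_le_mul_of_nonneg_left (hR l hl) hs
  rw [dist_eq_norm]
  calc ‖p + s • l - (⟪p, u⟫ + s * ⟪l, u⟫ - supportFn P u) • u - p‖
      = ‖s • l - (⟪p, u⟫ + s * ⟪l, u⟫ - supportFn P u) • u‖ := by congr 1; abel
    _ ≤ ‖s • l‖ + ‖(⟪p, u⟫ + s * ⟪l, u⟫ - supportFn P u) • u‖ := norm_sub_le _ _
    _ = s * ‖l‖ + (⟪p, u⟫ + s * ⟪l, u⟫ - supportFn P u) := by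
        rw [norm_smul, norm_smul, hN u hu, mul_one, Real.norm_of_nonneg hs,
          Real.norm_of_nonneg (by linarith)]
    _ ≤ 2 * R * s := by linarith

theorem sum_ofReal_mul_le_volume {N : Finset (EuclideanSpace ℝ (Fin (n + 1)))}
    (hP : IsCompact P) (hPc : Convex ℝ P) (hN : ∀ u ∈ N, ‖u‖ = 1)
    {x₀ : EuclideanSpace ℝ (Fin (n + 1))} (hx₀ : x₀ ∈ P)
    (hk : ∀ u ∈ N, ⟪x₀, u⟫ < supportFn P u) :
    ∑ u ∈ N, ENNReal.ofReal ((supportFn P u - ⟪x₀, u⟫) / (n + 1)) * μHE[n] (normalFace P u)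
      ≤ volume P := by
  set C : EuclideanSpace ℝ (Fin (n + 1)) → Set (EuclideanSpace ℝ (Fin (n + 1))) := fun u =>
    P ∩ {x | ∀ w ∈ N, ⟪x - x₀, w⟫ / (supportFn P w - ⟪x₀, w⟫)
      ≤ ⟪x - x₀, u⟫ / (supportFn P u - ⟪x₀, u⟫)} with hC
  have hCm : ∀ u, MeasurableSet (C u) := by
    intro u
    refine hP.measurableSet.inter (IsClosed.measurableSet ?_)
    simp only [Set.ofPred_forall]
    refine isClosed_biInter fun w _ => isClosed_le ?_ ?_
    · exact Continuous.div_const (by fun_prop) _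
    · exact Continuous.div_const (by fun_prop) _
  have hdisj : (N : Set (EuclideanSpace ℝ (Fin (n + 1)))).Pairwise
      (Function.onFun (AEDisjoint volume) C) := by
    intro u hu w hw huw
    have hu' := sub_pos.2 (hk u hu)
    have hw' := sub_pos.2 (hk w hw)
    set g := (supportFn P u - ⟪x₀, u⟫)⁻¹ • u - (supportFn P w - ⟪x₀, w⟫)⁻¹ • w with hg
    have hg0 : g ≠ 0 := by
      intro h0
      have heq := sub_eq_zero.1 h0
      have hnorm := congrArg norm heq
      rw [norm_smul, norm_smul, hN u hu, hN w hw, mul_one, mul_one,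
        Real.norm_of_nonneg (inv_pos.2 hu').le, Real.norm_of_nonneg (inv_pos.2 hw').le] at hnorm
      rw [hnorm] at heq
      exact huw (smul_right_injective _ (inv_pos.2 hw').ne' heq)
    refine measure_mono_null ?_ (volume_inner_eq_zero hg0 ⟪x₀, g⟫)
    rintro x ⟨⟨_, hxu⟩, ⟨_, hxw⟩⟩
    have e := le_antisymm (hxw u hu) (hxu w hw)
    have e' : ⟪x - x₀, g⟫ = 0 := by
      rw [hg, inner_sub_right, inner_smul_right, inner_smul_right, sub_eq_zero]
      simpa only [div_eq_inv_mul] using e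
    rw [inner_sub_left, sub_eq_zero] at e'
    exact e'
  calc ∑ u ∈ N, ENNReal.ofReal ((supportFn P u - ⟪x₀, u⟫) / (n + 1)) * μHE[n] (normalFace P u)
      ≤ ∑ u ∈ N, volume (C u) := by
        refine Finset.sum_le_sum fun u hu => ?_
        have hface := normalFace_eq_inter hP ⟨x₀, hx₀⟩ u
        refine ofReal_mul_le_volume_of_homothety_subset (hN u hu) (hCm u) ?_
          (hP.isBounded.subset fun y hy => hy.1) (hk u hu) ?_
        · intro y hy
          rw [hface] at hy
          exact hy.2
        · intro ρ hρ y hy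
          have hyP : y ∈ P := hy.1
          have hyu : ⟪y, u⟫ = supportFn P u := by
            rw [hface] at hy
            exact hy.2
          have hhom : AffineMap.homothety x₀ ρ y = x₀ + ρ • (y - x₀) := by
            simp [AffineMap.homothety_apply, add_comm]
          rw [hhom]
          refine ⟨hPc.add_smul_sub_mem hx₀ hyP ⟨hρ.1.le, hρ.2⟩, fun w hw => ?_⟩
          rw [add_sub_cancel_left, inner_smul_left, inner_smul_left]
          simp only [conj_trivial, inner_sub_left, hyu]
          have hu' := sub_pos.2 (hk u hu)
          have hw' := sub_pos.2 (hk w hw)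
          rw [mul_div_assoc, mul_div_assoc, div_self hu'.ne']
          refine mul_le_mul_of_nonneg_left ((div_le_one hw').2 ?_) hρ.1.le
          have := inner_le_supportFn (u := w) hP hyP
          linarith
    _ = volume (⋃ u ∈ N, C u) :=
        (measure_biUnion_finset₀ hdisj fun u _ => (hCm u).nullMeasurableSet).symm
    _ ≤ volume P := measure_mono (by
        simp only [Set.iUnion_subset_iff]
        exact fun u _ => Set.inter_subset_left)

theorem inner_lt_supportFn (hP : IsCompact P) {x₀ : EuclideanSpace ℝ (Fin (n + 1))}
    (hx₀ : x₀ ∈ interior P) {u : EuclideanSpace ℝ (Fin (n + 1))} (hu : u ≠ 0) :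
    ⟪x₀, u⟫ < supportFn P u := by
  have hc : Continuous fun t : ℝ => x₀ + t • u := by fun_prop
  have hev : ∀ᶠ t in nhdsWithin (0 : ℝ) (Set.Ioi 0), x₀ + t • u ∈ interior P :=
    nhdsWithin_le_nhds (hc.continuousAt.eventually_mem
      (isOpen_interior.mem_nhds (by simpa using hx₀)))
  obtain ⟨t, htP, ht⟩ := (hev.and self_mem_nhdsWithin).exists
  have ht : 0 < t := ht
  have h1 := inner_le_supportFn (u := u) hP (interior_subset htP)
  rw [inner_add_left, inner_smul_left] at h1
  have h2 : 0 < ⟪u, u⟫ := real_inner_self_pos.2 hu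
  simp only [conj_trivial] at h1
  nlinarith

theorem le_of_sq_midpoint_of_first_variation {q σ : ℝ → ℝ} {V S : ℝ} {d : ℕ} (hV : 0 < V)
    (hq : ∀ t ∈ Set.Ioc (0 : ℝ) (1 / 2), V * q t ≤ q (t / 2) ^ 2)
    (hq0 : ∀ t, 0 ≤ q t)
    (hup : ∀ t ∈ Set.Ioc (0 : ℝ) (1 / 2),
      q t ≤ (1 - t) ^ d * (V + t / (1 - t) * σ (t / (1 - t))))
    (hσ : Filter.Tendsto σ (nhdsWithin 0 (Set.Ioi 0)) (nhds S)) (hσ0 : ∀ s, 0 ≤ σ s)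
    (hS : S ≤ d * V) : q (1 / 2) ≤ V := by
  by_contra! hlt
  set ε := Real.log (q (1 / 2) / V) with hε
  have hε0 : 0 < ε := Real.log_pos ((one_lt_div hV).2 hlt)
  have ht : ∀ k : ℕ, (1 / 2 : ℝ) ^ (k + 1) ∈ Set.Ioc (0 : ℝ) (1 / 2) := fun k => by
    refine ⟨by positivity, ?_⟩
    rw [pow_succ]
    have : (1 / 2 : ℝ) ^ k ≤ 1 := pow_le_one₀ (by norm_num) (by norm_num)
    linarith
  have hlow : ∀ k : ℕ, 0 < q ((1 / 2) ^ (k + 1)) ∧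
      2 * ε * (1 / 2) ^ (k + 1) ≤ Real.log (q ((1 / 2) ^ (k + 1)) / V) := by
    intro k
    induction k with
    | zero =>
      rw [zero_add, pow_one]
      exact ⟨hV.trans hlt, by linarith⟩
    | succ k ih =>
      have hb := hq _ (ht k)
      have hhalf : (1 / 2 : ℝ) ^ (k + 1) / 2 = (1 / 2) ^ (k + 1 + 1) := by
        rw [pow_succ (1 / 2 : ℝ) (k + 1)]; ring
      rw [hhalf] at hb
      have hpos : 0 < q ((1 / 2) ^ (k + 1 + 1)) := by
        refine lt_of_le_of_ne (hq0 _) fun h => ?_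
        rw [← h] at hb
        have := mul_pos hV ih.1
        norm_num at hb
        norm_num at this
        linarith
      refine ⟨hpos, ?_⟩
      have hlog := Real.log_le_log (div_pos ih.1 hV)
        (show q ((1 / 2) ^ (k + 1)) / V ≤ (q ((1 / 2) ^ (k + 1 + 1)) / V) ^ 2 by
          rw [div_pow (q _) V, div_le_div_iff₀ hV (by positivity)]
          nlinarith)
      rw [Real.log_pow] at hlog
      push_cast at hlog
      have := ih.2
      rw [← hhalf]
      rw [← hhalf] at hlog
      linarith
  have hupper : ∀ k : ℕ, 2 * ε + d ≤ (1 - (1 / 2 : ℝ) ^ (k + 1))⁻¹ *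
      σ ((1 / 2) ^ (k + 1) / (1 - (1 / 2) ^ (k + 1))) / V := by
    intro k
    obtain ⟨hqpos, hl⟩ := hlow k
    have htk := ht k
    have hu := hup _ htk
    set t := (1 / 2 : ℝ) ^ (k + 1)
    set s := σ (t / (1 - t)) with hs
    have hs0 : 0 ≤ s := hσ0 _
    have h1t : 0 < 1 - t := by linarith [htk.2]
    have ht0 := htk.1
    have hfac : q t / V ≤ (1 - t) ^ d * (1 + t / (1 - t) * s / V) := by
      rw [div_le_iff₀ hV]
      calc q t ≤ _ := hu
        _ = _ := by field_simp
    have hA : 0 ≤ t / (1 - t) * s / V := by positivity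
    have hlog := Real.log_le_log (div_pos hqpos hV) hfac
    rw [Real.log_mul (by positivity) (by positivity), Real.log_pow] at hlog
    have e1 : Real.log (1 - t) ≤ -t := by
      have := Real.log_le_sub_one_of_pos h1t
      linarith
    have e2 : Real.log (1 + t / (1 - t) * s / V) ≤ t / (1 - t) * s / V := by
      have := Real.log_le_sub_one_of_pos (show 0 < 1 + t / (1 - t) * s / V by positivity)
      linarith
    have e3 : (d : ℝ) * Real.log (1 - t) ≤ d * -t := by gcongr
    have e4 : t * (2 * ε + d) ≤ t * ((1 - t)⁻¹ * s / V) := by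
      calc t * (2 * ε + d) ≤ t / (1 - t) * s / V := by linarith
        _ = _ := by field_simp
    exact le_of_mul_le_mul_left e4 ht0
  have htend : Filter.Tendsto (fun k : ℕ => (1 / 2 : ℝ) ^ (k + 1)) Filter.atTop (nhds 0) :=
    (tendsto_pow_atTop_nhds_zero_of_lt_one (by norm_num) (by norm_num)).comp
      (Filter.tendsto_add_atTop_nat 1)
  have htend1 : Filter.Tendsto (fun k : ℕ => (1 - (1 / 2 : ℝ) ^ (k + 1))⁻¹) Filter.atTop
      (nhds (1 - 0)⁻¹) := (tendsto_const_nhds.sub htend).inv₀ (by norm_num)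
  have htend2 : Filter.Tendsto (fun k : ℕ => (1 / 2 : ℝ) ^ (k + 1) / (1 - (1 / 2) ^ (k + 1)))
      Filter.atTop (nhdsWithin 0 (Set.Ioi 0)) := by
    refine tendsto_nhdsWithin_iff.2 ⟨?_, Filter.Eventually.of_forall fun k => ?_⟩
    · simpa [div_eq_mul_inv] using htend.mul htend1
    · exact div_pos (ht k).1 (by linarith [(ht k).2])
  have hlim := ge_of_tendsto ((htend1.mul (hσ.comp htend2)).div_const V)
    (Filter.Eventually.of_forall hupper)
  rw [sub_zero, inv_one, one_mul] at hlim
  have : S / V ≤ d := (div_le_iff₀ hV).2 hS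
  linarith

end FacetVolumes

section CentralSymmetry

variable {n : ℕ}

theorem measureReal_mul_measureReal_le_sq {d : ℕ} {A B C : Set (EuclideanSpace ℝ (Fin d))}
    (hA : IsCompact A) (hB : IsCompact B) (hC : IsCompact C)
    (H : ∀ a ∈ A, ∀ b ∈ B, (1 / 2 : ℝ) • (a + b) ∈ C) :
    volume.real A * volume.real B ≤ volume.real C ^ 2 := by
  simp only [Measure.real]
  rw [← ENNReal.toReal_mul, ← ENNReal.toReal_pow]
  exact ENNReal.toReal_mono (ENNReal.pow_ne_top hC.measure_ne_top)
    (volume_mul_volume_le_sq hA.measurableSet hB.measurableSet hC.measurableSet hA.isBounded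
      hB.isBounded H)

theorem exists_eq_vadd_neg_of_facet_volumes {V : Finset (EuclideanSpace ℝ (Fin (n + 1)))}
    {P : Set (EuclideanSpace ℝ (Fin (n + 1)))} (hPV : P = convexHull ℝ (V : Set _))
    (hi : (interior P).Nonempty)
    (hsymm : ∀ u ∈ facetNormals P, -u ∈ facetNormals P ∧
      μHE[n] (normalFace P u) = μHE[n] (normalFace P (-u))) :
    ∃ v : EuclideanSpace ℝ (Fin (n + 1)), P = v +ᵥ (-P) := by
  have hfin : (facetNormals P).Finite := by
    subst hPV
    exact finite_facetNormals hi
  have hsep : ∀ x ∉ P, ∃ u ∈ facetNormals P, supportFn P u < ⟪x, u⟫ := by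
    subst hPV
    exact fun x hx => exists_facetNormal_of_notMem hi hx
  have hP : IsCompact P := hPV ▸ V.finite_toSet.isCompact_convexHull ℝ
  have hPc : Convex ℝ P := hPV ▸ convex_convexHull ℝ _
  clear hPV
  have hne : P.Nonempty := hi.mono interior_subset
  obtain ⟨x₀, hx₀⟩ := hi
  set N := hfin.toFinset with hNdef
  have hNmem : ∀ {u}, u ∈ N ↔ u ∈ facetNormals P := hfin.mem_toFinset
  have hN : ∀ u ∈ N, ‖u‖ = 1 := fun u hu => (hNmem.1 hu).1
  have hN0 : ∀ u ∈ N, u ≠ 0 := by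
    rintro u hu rfl
    simpa using hN _ hu
  set L : Set (EuclideanSpace ℝ (Fin (n + 1))) := x₀ +ᵥ (-P) with hL
  have hLk : IsCompact L := hP.neg.vadd x₀
  have hLc : Convex ℝ L := hPc.neg.vadd x₀
  have hLi : (interior L).Nonempty := by
    refine ⟨x₀ +ᵥ -x₀, interior_maximal (Set.vadd_set_mono (Set.neg_subset_neg.2 interior_subset))
      (isOpen_interior.neg.vadd x₀) (Set.vadd_mem_vadd_set (Set.neg_mem_neg.2 hx₀))⟩
  have hLV : volume.real L = volume.real P := by
    simp only [Measure.real, hL, measure_vadd, Measure.measure_neg]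
  have hVpos : 0 < volume.real P := ENNReal.toReal_pos
    (Measure.measure_pos_of_nonempty_interior volume ⟨x₀, hx₀⟩).ne' hP.measure_ne_top
  obtain ⟨R, hR⟩ := hLk.isBounded.exists_norm_le
  set k : EuclideanSpace ℝ (Fin (n + 1)) → ℝ := fun u => ⟪x₀, u⟫ + supportFn P (-u) with hk
  have hkL : ∀ u ∈ N, ∀ l ∈ L, ⟪l, u⟫ ≤ k u := by
    rintro u - _ ⟨p, hp, rfl⟩
    have h1 := inner_le_supportFn (u := -u) hP (Set.mem_neg.1 hp)
    rw [inner_neg_neg] at h1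
    simp only [vadd_eq_add, inner_add_left, hk]
    linarith
  have hk0 : ∀ u ∈ N, 0 ≤ k u := by
    intro u hu
    have := inner_lt_supportFn hP hx₀ (neg_ne_zero.2 (hN0 u hu))
    rw [inner_neg_right] at this
    simp only [hk]
    linarith
  set m : EuclideanSpace ℝ (Fin (n + 1)) → ℝ → ENNReal := fun u δ =>
    μHE[n] (Metric.cthickening δ P ∩ {x | ⟪x, u⟫ = supportFn P u}) with hm
  have hmf : ∀ u ∈ N, ∀ δ, m u δ ≠ ⊤ := fun u hu δ =>
    (euclideanHausdorffMeasure_inter_hyperplane_lt_top (hN u hu) _ hP.isBounded.cthickening).ne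
  have haf : ∀ u ∈ N, μHE[n] (normalFace P u) ≠ ⊤ := fun u hu => by
    rw [normalFace_eq_inter hP hne]
    exact (euclideanHausdorffMeasure_inter_hyperplane_lt_top (hN u hu) _ hP.isBounded).ne
  set σ : ℝ → ℝ := fun s => ∑ u ∈ N, k u * (m u (2 * R * s)).toReal with hσ
  set q : ℝ → ℝ := fun t => volume.real ((1 - t) • P + t • L) with hq
  have hQk : ∀ t : ℝ, IsCompact ((1 - t) • P + t • L) := fun t => (hP.smul _).add (hLk.smul _)
  have hhalf : (1 - 1 / 2 : ℝ) • P + (1 / 2 : ℝ) • L = (1 / 2 : ℝ) • (P + L) := by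
    rw [smul_add]; norm_num
  have hadd : ∀ s : ℝ, 0 ≤ s → volume.real (P + s • L) ≤ volume.real P + s * σ s := by
    intro s hs
    have h := volume_add_smul_le hP hN (fun x hx => by simpa only [hNmem] using hsep x hx) hLk hkL
      hR hs
    have hsum : ∀ u ∈ N, ENNReal.ofReal (s * k u) * m u (2 * R * s) ≠ ⊤ := fun u hu =>
      ENNReal.mul_ne_top ENNReal.ofReal_ne_top (hmf u hu _)
    have h' := ENNReal.toReal_mono
      (ENNReal.add_ne_top.2 ⟨hP.measure_ne_top, ENNReal.sum_ne_top.2 hsum⟩) h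
    rw [ENNReal.toReal_add hP.measure_ne_top (ENNReal.sum_ne_top.2 hsum),
      ENNReal.toReal_sum hsum] at h'
    refine h'.trans (le_of_eq ?_)
    simp only [Measure.real, hσ, Finset.mul_sum]
    congr 1
    refine Finset.sum_congr rfl fun u hu => ?_
    rw [ENNReal.toReal_mul, ENNReal.toReal_ofReal (mul_nonneg hs (hk0 u hu)), mul_assoc]
  have hσlim : Filter.Tendsto σ (nhdsWithin 0 (Set.Ioi 0))
      (nhds (∑ u ∈ N, k u * (μHE[n] (normalFace P u)).toReal)) := by
    refine tendsto_finsetSum _ fun u hu => Filter.Tendsto.const_mul _ ?_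
    refine (ENNReal.tendsto_toReal (haf u hu)).comp ?_
    have h1 := tendsto_measure_hyperplane_inter_cthickening (hN u hu) hP (supportFn P u)
    rw [← normalFace_eq_inter hP hne] at h1
    refine h1.comp (Filter.Tendsto.mono_left ?_ nhdsWithin_le_nhds)
    have : Continuous fun s : ℝ => 2 * R * s := by fun_prop
    simpa using this.tendsto 0
  have hS : ∑ u ∈ N, k u * (μHE[n] (normalFace P u)).toReal ≤ ((n + 1 : ℕ) : ℝ) * volume.real P := by
    have hlt : ∀ u ∈ N, ⟪x₀, u⟫ < supportFn P u := fun u hu => inner_lt_supportFn hP hx₀ (hN0 u hu)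
    have h := sum_ofReal_mul_le_volume hP hPc hN (interior_subset hx₀) hlt
    have hsum : ∀ u ∈ N, ENNReal.ofReal ((supportFn P u - ⟪x₀, u⟫) / (n + 1)) *
        μHE[n] (normalFace P u) ≠ ⊤ := fun u hu =>
      ENNReal.mul_ne_top ENNReal.ofReal_ne_top (haf u hu)
    have h' := ENNReal.toReal_mono hP.measure_ne_top h
    rw [ENNReal.toReal_sum hsum] at h'
    have hswap : ∑ u ∈ N, k u * (μHE[n] (normalFace P u)).toReal
        = ∑ u ∈ N, (supportFn P u - ⟪x₀, u⟫) * (μHE[n] (normalFace P u)).toReal := by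
      have hneg : ∀ u ∈ N, -u ∈ N := fun u hu => hNmem.2 (hsymm u (hNmem.1 hu)).1
      refine Finset.sum_nbij' (fun u => -u) (fun u => -u) hneg hneg (fun u _ => neg_neg u)
        (fun u _ => neg_neg u) fun u hu => ?_
      rw [(hsymm u (hNmem.1 hu)).2, inner_neg_right]
      simp only [hk]
      ring
    rw [hswap]
    have hcalc : ∑ u ∈ N, (supportFn P u - ⟪x₀, u⟫) * (μHE[n] (normalFace P u)).toReal
        = ((n + 1 : ℕ) : ℝ) * ∑ u ∈ N, (ENNReal.ofReal ((supportFn P u - ⟪x₀, u⟫) / (n + 1)) *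
        μHE[n] (normalFace P u)).toReal := by
      rw [Finset.mul_sum]
      refine Finset.sum_congr rfl fun u hu => ?_
      rw [ENNReal.toReal_mul, ENNReal.toReal_ofReal
        (div_nonneg (sub_nonneg.2 (hlt u hu).le) (by positivity))]
      push_cast
      field_simp
    rw [hcalc]
    exact mul_le_mul_of_nonneg_left h' (by positivity)
  have hle : q (1 / 2) ≤ volume.real P := by
    refine le_of_sq_midpoint_of_first_variation (d := n + 1) hVpos ?_ (fun t => measureReal_nonneg)
      ?_ hσlim (fun s => Finset.sum_nonneg fun u hu =>
        mul_nonneg (hk0 u hu) ENNReal.toReal_nonneg) hS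
    · intro t ht
      refine measureReal_mul_measureReal_le_sq hP (hQk t) (hQk (t / 2)) ?_
      rintro a ha _ ⟨_, ⟨p, hp, rfl⟩, _, ⟨l, hl, rfl⟩, rfl⟩
      have hpos : 0 < 1 - t / 2 := by linarith [ht.2]
      have hmem : ((1 / 2) / (1 - t / 2)) • a + ((1 - t) / 2 / (1 - t / 2)) • p ∈ P := by
        refine hPc ha hp (by positivity) ?_ ?_
        · exact div_nonneg (by linarith [ht.2]) hpos.le
        · rw [← add_div, div_eq_one_iff_eq hpos.ne']; ring
      refine ⟨_, Set.smul_mem_smul_set hmem, _, Set.smul_mem_smul_set hl, ?_⟩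
      simp only [smul_add, smul_smul]
      rw [mul_div_cancel₀ _ hpos.ne', mul_div_cancel₀ _ hpos.ne', add_assoc]
      congr 3 <;> ring
    · intro t ht
      have h1t : 0 < 1 - t := by linarith [ht.2]
      have hset : (1 - t) • P + t • L = (1 - t) • (P + (t / (1 - t)) • L) := by
        rw [smul_add, smul_smul, mul_div_cancel₀ _ h1t.ne']
      have hvol : q t = (1 - t) ^ (n + 1) * volume.real (P + (t / (1 - t)) • L) := by
        simp only [hq, hset, Measure.real, Measure.addHaar_smul, finrank_euclideanSpace_fin]
        rw [ENNReal.toReal_mul, ENNReal.toReal_ofReal (abs_nonneg _),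
          abs_of_nonneg (by positivity)]
      rw [hvol]
      exact mul_le_mul_of_nonneg_left (hadd _ (div_nonneg ht.1.le h1t.le)) (by positivity)
  have hge : volume.real P ≤ q (1 / 2) := by
    have h := measureReal_mul_measureReal_le_sq hP hLk (hQk (1 / 2)) fun a ha b hb => by
      rw [hhalf]
      exact Set.smul_mem_smul_set (Set.add_mem_add ha hb)
    rw [hLV, ← sq] at h
    exact (sq_le_sq₀ hVpos.le measureReal_nonneg).1 h
  obtain ⟨g, hg⟩ := exists_eq_vadd_of_volume_midpoint_eq hPc hP ⟨x₀, hx₀⟩ hLc hLk hLi hLV.symm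
    (by rw [← hhalf]; exact le_antisymm hle hge)
  exact ⟨g + x₀, by rw [add_vadd]; exact hg⟩

end CentralSymmetry

theorem normalFace_neg_eq_image_subLeft {d : ℕ} {P : Set (EuclideanSpace ℝ (Fin d))}
    {v : EuclideanSpace ℝ (Fin d)} (hP : P = v +ᵥ (-P)) (w : EuclideanSpace ℝ (Fin d)) :
    normalFace P (-w) = IsometryEquiv.subLeft v '' normalFace P w := by
  have hmem : ∀ x ∈ P, v - x ∈ P := by
    intro x hx
    rw [hP] at hx
    obtain ⟨p, hp, rfl⟩ := hx
    simpa using hp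
  ext x
  constructor
  · rintro ⟨hx, h⟩
    refine ⟨v - x, ⟨hmem x hx, fun y hy => ?_⟩, by simp⟩
    have := h _ (hmem y hy)
    simp only [inner_sub_left, inner_neg_right] at this ⊢
    linarith
  · rintro ⟨x, ⟨hx, h⟩, rfl⟩
    refine ⟨hmem x hx, fun y hy => ?_⟩
    have := h _ (hmem y hy)
    simp only [inner_sub_left, inner_neg_right, IsometryEquiv.subLeft_apply] at this ⊢
    linarith

theorem vectorSpan_image_subLeft {d : ℕ} (v : EuclideanSpace ℝ (Fin d))
    (S : Set (EuclideanSpace ℝ (Fin d))) :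
    vectorSpan ℝ (IsometryEquiv.subLeft v '' S) = vectorSpan ℝ S := by
  have h : ∀ T : Set (EuclideanSpace ℝ (Fin d)),
      vectorSpan ℝ (IsometryEquiv.subLeft v '' T) ≤ vectorSpan ℝ T := by
    intro T
    refine Submodule.span_le.2 ?_
    rintro _ ⟨_, ⟨a, ha, rfl⟩, _, ⟨b, hb, rfl⟩, rfl⟩
    have : (v - a) - (v - b) = b - a := by abel
    simpa [this] using vsub_mem_vectorSpan ℝ hb ha
  refine le_antisymm (h S) ?_
  have := h (IsometryEquiv.subLeft v '' S)
  rwa [Set.image_image, show (fun x => IsometryEquiv.subLeft v (IsometryEquiv.subLeft v x)) = id by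
    ext1 x; simp, Set.image_id] at this

/-- A `d`-dimensional polytope `P` is centrally symmetric iff every facet
`F` of `P` has an opposite parallel facet (the face in the opposite outer normal
direction) of equal `(d−1)`-dimensional Euclidean volume. -/
theorem centrally_symmetric_iff_facet_volumes
    (d : ℕ) (V : Finset (EuclideanSpace ℝ (Fin d))) (hV : V.Nonempty)
    (P : Set (EuclideanSpace ℝ (Fin d))) (hP : P = convexHull ℝ (V : Set (EuclideanSpace ℝ (Fin d))))
    (hdim : affineSpan ℝ P = ⊤) :
    (∃ v : EuclideanSpace ℝ (Fin d), P = v +ᵥ (-P)) ↔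
      ∀ F : Set (EuclideanSpace ℝ (Fin d)), IsFacetOf F P →
        ∃ v : EuclideanSpace ℝ (Fin d), v ≠ 0 ∧ F = normalFace P v ∧
          IsFacetOf (normalFace P (-v)) P ∧
          μH[((d : ℝ) - 1)] F = μH[((d : ℝ) - 1)] (normalFace P (-v)) := by
  have hPk : IsCompact P := hP ▸ V.finite_toSet.isCompact_convexHull ℝ
  have hPc : Convex ℝ P := hP ▸ convex_convexHull ℝ _
  have hne : P.Nonempty := hP ▸ (Finset.coe_nonempty.2 hV).convexHull
  have hi : (interior P).Nonempty := hPc.interior_nonempty_iff_affineSpan_eq_top.2 hdim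
  constructor
  · rintro ⟨v, hv⟩ F ⟨⟨w, hw, rfl⟩, hF⟩
    have himg := normalFace_neg_eq_image_subLeft hv w
    refine ⟨w, hw, rfl, ⟨⟨-w, neg_ne_zero.2 hw, rfl⟩, ?_⟩, ?_⟩
    · rw [direction_affineSpan] at hF ⊢
      rw [himg, vectorSpan_image_subLeft, hF]
    · rw [himg, IsometryEquiv.hausdorffMeasure_image]
  · intro h
    cases d with
    | zero =>
      refine ⟨0, ?_⟩
      obtain ⟨p, hp⟩ := hne
      rw [Set.Subsingleton.eq_singleton_of_mem Set.subsingleton_of_subsingleton hp, zero_vadd,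
        Set.neg_singleton, Subsingleton.elim (-p) p]
    | succ n =>
      refine exists_eq_vadd_neg_of_facet_volumes hP hi fun u hu => ?_
      have hu0 : u ≠ 0 := by
        rintro rfl
        simpa using hu.1
      obtain ⟨w, hw, hFw, hF, hμ⟩ := h (normalFace P u)
        ⟨⟨u, hu0, rfl⟩, by rw [direction_affineSpan]; exact hu.2⟩
      have hop : normalFace P (-w) = normalFace P (-u) := by
        rw [eq_norm_smul_of_normalFace_eq hPk hi hu hw hFw, ← smul_neg,
          normalFace_smul P (norm_pos_iff.2 hw)]
      rw [hop] at hF hμ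
      refine ⟨⟨(norm_neg u).trans hu.1, by rw [← direction_affineSpan]; exact hF.2⟩, ?_⟩
      have hn : ((n + 1 : ℕ) : ℝ) - 1 = n := by push_cast; ring
      rw [hn] at hμ
      rw [Measure.euclideanHausdorffMeasure_def, Measure.smul_apply, Measure.smul_apply, hμ]
end
end
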